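/- arXiv:1710.09336 — 3 statements merged into one kernel-verified Lean document; each statement's English description precedes it below -/
import Mathlib

section
/- Let T be a complete first-order L-theory with trivial definable closure, let χ(x̄) be a first-order formula in n variables such that T contains χ(x̄) → ⋀_{i≠j} x_i ≠ x_j and T contains ∃x̄ χ(x̄), and suppose there exists a model M ⊨ T that is χ-rooted with respect to complete first-order types. Then the set of properly ergodic structures μ with μ(⟦φ⟧) = 1 for every φ ∈ T has cardinality 2^ℵ₀. -/
open FirstOrder Language MeasureTheory Set
open scoped ENNReal

namespace Ergo

/-- The space of L-structures with domain ℕ. -/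
abbrev StrL (L : FirstOrder.Language.{0,0}) : Type :=
  ∀ n : ℕ, L.Relations n → (Fin n → ℕ) → Bool

variable (L : FirstOrder.Language.{0,0})

/-- The L-structure on ℕ coded by a point of `StrL L`. -/
def toStructure [L.IsRelational] (x : StrL L) : L.Structure ℕ where
  funMap := fun f _ => isEmptyElim f
  RelMap := fun {n} r a => x n r a = true

/-- The logic action of a permutation of ℕ on `StrL L`. -/
def act (σ : Equiv.Perm ℕ) (x : StrL L) : StrL L :=
  fun n r a => x n r (fun i => σ.symm (a i))

/-- Satisfaction of a sentence at a point of `StrL L`. -/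
def SatS [L.IsRelational] (x : StrL L) (φ : L.Sentence) : Prop :=
  letI := toStructure L x
  Sentence.Realize ℕ φ

/-- Satisfaction of a formula at a point of `StrL L` under an assignment. -/
def SatF [L.IsRelational] (x : StrL L) {n : ℕ} (φ : L.Formula (Fin n)) (a : Fin n → ℕ) : Prop :=
  letI := toStructure L x
  Formula.Realize φ a

/-- `⟦φ⟧`, the set of structures satisfying the sentence φ. -/
def extS [L.IsRelational] (φ : L.Sentence) : Set (StrL L) := {x | SatS L x φ}

/-- `⟦φ(ā)⟧`, the set of structures satisfying φ(ā). -/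
def extF [L.IsRelational] {n : ℕ} (φ : L.Formula (Fin n)) (a : Fin n → ℕ) : Set (StrL L) :=
  {x | SatF L x φ a}

/-- Invariance of a measure under the logic action. -/
def Invariant (μ : Measure (StrL L)) : Prop :=
  ∀ (σ : Equiv.Perm ℕ) (X : Set (StrL L)), MeasurableSet X → μ (act L σ '' X) = μ X

/-- An ergodic structure: an ergodic invariant Borel probability measure on `StrL L`. -/
def IsErgodicStructure (μ : Measure (StrL L)) : Prop :=
  IsProbabilityMeasure μ ∧ Invariant L μ ∧
    ∀ X : Set (StrL L), MeasurableSet X →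
      (∀ σ : Equiv.Perm ℕ, μ (symmDiff X (act L σ '' X)) = 0) → μ X = 0 ∨ μ X = 1

/-- The isomorphism class (orbit of the logic action) of a point of `StrL L`. -/
def IsoClass (M : StrL L) : Set (StrL L) := {N | ∃ σ : Equiv.Perm ℕ, act L σ M = N}

/-- All isomorphism classes are null: the defining property of proper ergodicity. -/
def OrbitsNull (μ : Measure (StrL L)) : Prop := ∀ M : StrL L, μ (IsoClass L M) = 0

/-- Realization of a formula in an explicitly given structure. -/
def RealizeIn (M : Type) (iM : L.Structure M) {n : ℕ} (φ : L.Formula (Fin n))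
    (a : Fin n → M) : Prop :=
  letI := iM
  Formula.Realize φ a

/-- Satisfaction of a sentence in an explicitly given structure. -/
def SatSIn (M : Type) (iM : L.Structure M) (φ : L.Sentence) : Prop :=
  letI := iM
  Sentence.Realize M φ

/-- A complete first-order n-type: the set of formulas satisfied by a fixed tuple
in some L-structure. -/
def IsCompleteType (n : ℕ) (p : Set (L.Formula (Fin n))) : Prop :=
  ∃ (M : Type) (iM : L.Structure M) (a : Fin n → M), p = {φ | RealizeIn L M iM φ a}

/-- A complete quantifier-free n-type. -/
def IsQfCompleteType (n : ℕ) (p : Set (L.Formula (Fin n))) : Prop :=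
  ∃ (M : Type) (iM : L.Structure M) (a : Fin n → M),
    p = {φ | φ.IsQF ∧ RealizeIn L M iM φ a}

/-- A type is non-redundant if it contains `xᵢ ≠ xⱼ` for all `i ≠ j`. -/
def NonRedundant (n : ℕ) (p : Set (L.Formula (Fin n))) : Prop :=
  ∀ i j : Fin n, i ≠ j → BoundedFormula.not (Term.equal (Term.var i) (Term.var j)) ∈ p

/-- The set of structures in which the canonical distinct tuple (0,…,n−1) realizes p;
`μ` of this set is the measure `μ(p)` of the type `p`. -/
def typeSet [L.IsRelational] {n : ℕ} (p : Set (L.Formula (Fin n))) : Set (StrL L) :=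
  {x | ∀ φ ∈ p, SatF L x φ (fun i => (i : ℕ))}

/-- Realization of (all formulas of) a type in an explicit structure by a tuple. -/
def RealizesTypeIn (M : Type) (iM : L.Structure M) {n : ℕ} (p : Set (L.Formula (Fin n)))
    (a : Fin n → M) : Prop :=
  ∀ φ ∈ p, RealizeIn L M iM φ a

/-- χ-rootedness with respect to quantifier-free types. -/
def ChiRootedQfOn (M : Type) (iM : L.Structure M) {n : ℕ} (χ : L.Formula (Fin n)) : Prop :=
  ∀ p : Set (L.Formula (Fin n)), IsQfCompleteType L n p → NonRedundant L n p → χ ∈ p →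
    (∃ a, RealizesTypeIn L M iM p a) →
    ∃ r : M, ∀ a, RealizesTypeIn L M iM p a → ∃ i, a i = r

/-- χ-rootedness with respect to complete first-order types. -/
def ChiRootedFullOn (M : Type) (iM : L.Structure M) {n : ℕ} (χ : L.Formula (Fin n)) : Prop :=
  ∀ p : Set (L.Formula (Fin n)), IsCompleteType L n p → NonRedundant L n p → χ ∈ p →
    (∃ a, RealizesTypeIn L M iM p a) →
    ∃ r : M, ∀ a, RealizesTypeIn L M iM p a → ∃ i, a i = r

section IID

variable {Ω : Type} [MeasurableSpace Ω] (m : Measure Ω) [IsProbabilityMeasure m]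

/-- The law of an i.i.d. sequence with law `m`. -/
noncomputable abbrev iid : Measure (ℕ → Ω) := Measure.infinitePi (fun _ : ℕ => m)

lemma iid_map_comp {ι : Type} {f : ι → ℕ} (hf : Function.Injective f) :
    (iid m).map (fun ω i => ω (f i)) = Measure.infinitePi (fun _ : ι => m) :=
  Measure.map_infinitePi_infinitePi_of_inj (P := fun _ : ℕ => m) hf

lemma measurable_comp_index {ι : Type} (f : ι → ℕ) :
    Measurable (fun (ω : ℕ → Ω) i => ω (f i)) :=
  measurable_pi_lambda _ fun i => measurable_pi_apply (f i)

lemma iid_reindex (σ : Equiv.Perm ℕ) : (iid m).map (fun ω i => ω (σ i)) = iid m :=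
  iid_map_comp m σ.injective

lemma exists_perm_ge (N : ℕ) : ∃ σ : Equiv.Perm ℕ, ∀ i < N, N ≤ σ i := by
  let f : ℕ → ℕ := fun i => if i < N then i + N else if i < 2 * N then i - N else i
  have hf : Function.Involutive f := by
    intro i
    simp only [f]
    split_ifs <;> omega
  refine ⟨hf.toPerm f, fun i hi => ?_⟩
  simp [Function.Involutive.toPerm, f, hi]

lemma iid_inter_of_disjoint (S T : Finset ℕ) (hST : Disjoint S T)
    {A : Set (S → Ω)} {B : Set (T → Ω)} (hA : MeasurableSet A) (hB : MeasurableSet B) :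
    iid m ({ω | (fun i : S => ω i) ∈ A} ∩ {ω | (fun i : T => ω i) ∈ B}) =
      iid m {ω | (fun i : S => ω i) ∈ A} * iid m {ω | (fun i : T => ω i) ∈ B} := by
  have h : ProbabilityTheory.iIndepFun (fun (i : ℕ) (ω : ℕ → Ω) => ω i) (iid m) :=
    ProbabilityTheory.iIndepFun_infinitePi (X := fun _ x => x) (fun _ => measurable_id)
  have h2 := h.indepFun_finset S T hST (fun i => measurable_pi_apply i)
  exact h2.measure_inter_preimage_eq_mul A B hA hB

lemma iid_inter_comp_of_disjoint {n : ℕ} (b c : Fin n → ℕ) (hbc : ∀ i j, b i ≠ c j)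
    {A B : Set (Fin n → Ω)} (hA : MeasurableSet A) (hB : MeasurableSet B) :
    iid m ({ω | (fun i => ω (b i)) ∈ A} ∩ {ω | (fun i => ω (c i)) ∈ B}) =
      iid m {ω | (fun i => ω (b i)) ∈ A} * iid m {ω | (fun i => ω (c i)) ∈ B} := by
  classical
  let S : Finset ℕ := Finset.univ.image b
  let T : Finset ℕ := Finset.univ.image c
  have hb : ∀ i, b i ∈ S := fun i => Finset.mem_image_of_mem b (Finset.mem_univ i)
  have hc : ∀ i, c i ∈ T := fun i => Finset.mem_image_of_mem c (Finset.mem_univ i)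
  have hST : Disjoint S T := by
    rw [Finset.disjoint_left]
    simp only [S, T, Finset.mem_image, Finset.mem_univ, true_and]
    rintro _ ⟨i, rfl⟩ ⟨j, hj⟩
    exact hbc i j hj.symm
  have hm1 : Measurable (fun (x : S → Ω) (i : Fin n) => x ⟨b i, hb i⟩) :=
    measurable_pi_lambda _ fun i => measurable_pi_apply _
  have hm2 : Measurable (fun (x : T → Ω) (i : Fin n) => x ⟨c i, hc i⟩) :=
    measurable_pi_lambda _ fun i => measurable_pi_apply _
  exact iid_inter_of_disjoint m S T hST (hm1 hA) (hm2 hB)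

/-- The Hewitt–Savage zero-one law. -/
lemma iid_zero_one {Y : Set (ℕ → Ω)} (hY : MeasurableSet Y)
    (hinv : ∀ σ : Equiv.Perm ℕ, iid m (symmDiff Y ((fun ω i => ω (σ i)) ⁻¹' Y)) = 0) :
    iid m Y = 0 ∨ iid m Y = 1 := by
  classical
  set P := iid m with hP
  have key : ∀ ε : ℝ, 0 < ε → |P.real Y - P.real Y ^ 2| ≤ 4 * ε := by
    intro ε hε
    obtain ⟨t, ht, htY⟩ := exists_measure_symmDiff_lt_of_generateFrom_isSetRing (μ := P)
      (C := measurableCylinders (fun _ : ℕ => Ω)) isSetRing_measurableCylinders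
      ⟨{Set.univ}, Set.countable_singleton _, by
        simpa using univ_mem_measurableCylinders (fun _ : ℕ => Ω), by simp⟩
      generateFrom_measurableCylinders.symm hY (ε := ENNReal.ofReal ε) (by simpa using hε)
    have htm : MeasurableSet t := MeasurableSet.of_mem_measurableCylinders ht
    obtain ⟨S, A, hA, rfl⟩ := (mem_measurableCylinders _).1 ht
    obtain ⟨σ, hσ⟩ := exists_perm_ge (S.sup id + 1)
    have hSlt : ∀ i ∈ S, i < S.sup id + 1 := fun i hi =>
      Nat.lt_succ_of_le (Finset.le_sup (f := id) hi)
    set τ : (ℕ → Ω) → (ℕ → Ω) := fun ω i => ω (σ i) with hτ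
    have hτm : Measurable τ := measurable_comp_index _
    have hmap : P.map τ = P := iid_reindex m σ
    have hpre : ∀ X, MeasurableSet X → P.real (τ ⁻¹' X) = P.real X := by
      intro X hX
      rw [measureReal_def, measureReal_def, ← Measure.map_apply hτm hX, hmap]
    set t : Set (ℕ → Ω) := cylinder (α := fun _ : ℕ => Ω) S A with htdef
    set t' := τ ⁻¹' t with ht'
    have ht'm : MeasurableSet t' := hτm htm
    have h1 : P.real (symmDiff t Y) < ε := by
      rw [measureReal_def]
      exact (ENNReal.lt_ofReal_iff_toReal_lt (measure_ne_top _ _)).1 htY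
    have h2 : P.real (symmDiff t' (τ ⁻¹' Y)) < ε := by
      have : symmDiff t' (τ ⁻¹' Y) = τ ⁻¹' (symmDiff t Y) := by
        rw [ht', Set.preimage_symmDiff]
      rw [this, hpre _ (htm.symmDiff hY)]
      exact h1
    have h3 : P.real (symmDiff Y (τ ⁻¹' Y)) = 0 := by
      rw [measureReal_def, hinv σ]; rfl
    have hind : P.real (t ∩ t') = P.real t * P.real t' := by
      have : P (t ∩ t') = P t * P t' := by
        let T : Finset ℕ := S.image σ
        have hST : Disjoint S T := by
          rw [Finset.disjoint_left]
          intro i hi hiT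
          obtain ⟨j, hj, rfl⟩ := Finset.mem_image.1 hiT
          have := hσ j (hSlt j hj)
          have := hSlt _ hi
          omega
        have hmT : Measurable
            (fun (x : T → Ω) (i : S) => x ⟨σ i, Finset.mem_image_of_mem σ i.2⟩) :=
          measurable_pi_lambda _ fun i => measurable_pi_apply _
        exact iid_inter_of_disjoint m S T hST hA (hmT hA)
      rw [measureReal_def, this, ENNReal.toReal_mul]; rfl
    have ht't : P.real t' = P.real t := hpre t htm
    have d1 : P.real (symmDiff Y (t ∩ t')) ≤ 2 * ε := by
      have hsub : symmDiff Y (t ∩ t') ⊆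
          symmDiff t Y ∪ (symmDiff t' (τ ⁻¹' Y) ∪ symmDiff Y (τ ⁻¹' Y)) := by
        intro x hx
        simp only [Set.mem_symmDiff, Set.mem_union, Set.mem_inter_iff] at hx ⊢
        tauto
      have e1 := measureReal_mono (μ := P) hsub
      have e2 := measureReal_union_le (μ := P) (symmDiff t Y)
        (symmDiff t' (τ ⁻¹' Y) ∪ symmDiff Y (τ ⁻¹' Y))
      have e3 := measureReal_union_le (μ := P) (symmDiff t' (τ ⁻¹' Y)) (symmDiff Y (τ ⁻¹' Y))
      linarith
    have a1 := abs_measureReal_sub_le_measureReal_symmDiff (μ := P)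
      hY.nullMeasurableSet (htm.inter ht'm).nullMeasurableSet
    have a2 := abs_measureReal_sub_le_measureReal_symmDiff (μ := P)
      htm.nullMeasurableSet hY.nullMeasurableSet
    rw [hind, ht't] at a1
    have b1 : P.real t ≤ 1 := measureReal_le_one
    have b2 : P.real Y ≤ 1 := measureReal_le_one
    have b3 : 0 ≤ P.real t := measureReal_nonneg
    have b4 : 0 ≤ P.real Y := measureReal_nonneg
    have a3 : |P.real t - P.real Y| ≤ ε := a2.trans h1.le
    have a4 : |P.real Y - P.real t * P.real t| ≤ 2 * ε := a1.trans d1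
    rw [abs_le] at a3 a4 ⊢
    constructor <;> nlinarith
  have h0 : P.real Y - P.real Y ^ 2 = 0 := by
    rw [← abs_nonpos_iff]
    refine le_of_forall_pos_le_add fun ε hε => ?_
    have := key (ε / 4) (by positivity)
    linarith
  have h1 : P.real Y = 0 ∨ P.real Y = 1 := by
    have : P.real Y * (1 - P.real Y) = 0 := by linarith
    rcases mul_eq_zero.1 this with h | h
    · exact Or.inl h
    · right; linarith
  rcases h1 with h | h
  · exact Or.inl ((measureReal_eq_zero_iff).1 h)
  · right
    rw [measureReal_def] at h
    rw [← ENNReal.ofReal_toReal (measure_ne_top P Y), h, ENNReal.ofReal_one]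

end IID

lemma infinitePi_box_eq_zero {X : Type} [MeasurableSpace X] (q : Measure X)
    [IsProbabilityMeasure q] (A : ℕ → Set X) (hA : ∀ k, MeasurableSet (A k)) {ρ : ℝ≥0∞}
    (hρ : ρ < 1) (hq : ∀ k, q (A k) ≤ ρ) (K : ℕ) :
    Measure.infinitePi (fun _ : ℕ => q) {x | ∀ k, K ≤ k → x k ∈ A k} = 0 := by
  have h : ∀ N : ℕ, Measure.infinitePi (fun _ : ℕ => q) {x | ∀ k, K ≤ k → x k ∈ A k} ≤ ρ ^ N := by
    intro N
    calc Measure.infinitePi (fun _ : ℕ => q) {x | ∀ k, K ≤ k → x k ∈ A k}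
        ≤ Measure.infinitePi (fun _ : ℕ => q) (Set.pi (Finset.Ico K (K + N)) A) := by
          refine measure_mono fun x hx k hk => hx k ?_
          simp at hk
          exact hk.1
      _ = ∏ k ∈ Finset.Ico K (K + N), q (A k) := Measure.infinitePi_pi _ (fun i _ => hA i)
      _ ≤ ∏ k ∈ Finset.Ico K (K + N), ρ := Finset.prod_le_prod' fun k _ => hq k
      _ = ρ ^ N := by simp
  exact le_antisymm (ge_of_tendsto' (ENNReal.tendsto_pow_atTop_nhds_zero_of_lt_one hρ) h) bot_le

section Sampling

variable {L}

lemma measurable_act (σ : Equiv.Perm ℕ) : Measurable (act L σ) :=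
  measurable_pi_lambda _ fun n => measurable_pi_lambda _ fun r => measurable_pi_lambda _ fun a =>
    (measurable_pi_apply (fun i => σ.symm (a i))).comp
      ((measurable_pi_apply r).comp (measurable_pi_apply n))

lemma act_image (σ : Equiv.Perm ℕ) (X : Set (StrL L)) :
    act L σ '' X = act L σ.symm ⁻¹' X := by
  refine Set.image_eq_preimage_of_inverse (f := act L σ) (g := act L σ.symm) ?_ ?_ ▸ rfl
  · intro x; funext n r a; simp [act]
  · intro x; funext n r a; simp [act]

variable {Ω : Type} [MeasurableSpace Ω] (m : Measure Ω) [IsProbabilityMeasure m]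

lemma iid_map_isErgodicStructure {Φ : (ℕ → Ω) → StrL L} (hΦ : Measurable Φ)
    (hequiv : ∀ (σ : Equiv.Perm ℕ) (ω : ℕ → Ω),
      Φ (fun i => ω (σ i)) = act L σ.symm (Φ ω)) :
    IsErgodicStructure L ((iid m).map Φ) := by
  have hpre : ∀ (σ : Equiv.Perm ℕ) (X : Set (StrL L)),
      Φ ⁻¹' (act L σ.symm ⁻¹' X) = (fun ω i => ω (σ i)) ⁻¹' (Φ ⁻¹' X) := by
    intro σ X
    ext ω
    simp [hequiv]
  refine ⟨Measure.isProbabilityMeasure_map hΦ.aemeasurable, ?_, ?_⟩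
  · intro σ X hX
    rw [act_image, Measure.map_apply hΦ (measurable_act _ hX), Measure.map_apply hΦ hX, hpre,
      ← Measure.map_apply (measurable_comp_index _) (hΦ hX), iid_reindex]
  · intro X hX hinv
    rw [Measure.map_apply hΦ hX]
    refine iid_zero_one m (hΦ hX) fun σ => ?_
    have := hinv σ
    rw [act_image, Measure.map_apply hΦ (hX.symmDiff (measurable_act _ hX)),
      Set.preimage_symmDiff, hpre] at this
    exact this

end Sampling

section ModelTheory

variable {L} {M : Type} [L.Structure M] {n : ℕ}

/-- Formulas with parameters `Fin n` and finitely many further free variables. -/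
abbrev AllF (L : FirstOrder.Language.{0,0}) (n : ℕ) : Type := Σ l, L.BoundedFormula (Fin n) l

/-- Trivial definable closure inside a fixed structure. -/
def TrivDcl (L : FirstOrder.Language.{0,0}) (M : Type) [L.Structure M] : Prop :=
  ∀ (p : ℕ) (φ : L.Formula (Fin (p + 1))) (a : Fin p → M) (b : M), (∀ i, b ≠ a i) →
    φ.Realize (Fin.snoc a b : Fin (p + 1) → M) →
    ∃ b', b' ≠ b ∧ (∀ i, b' ≠ a i) ∧ φ.Realize (Fin.snoc a b' : Fin (p + 1) → M)

open Classical in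
lemma exists_twin (hdcl : TrivDcl L M) (Δ : Finset (AllF L n)) (A : Finset M) (b : M)
    (hb : b ∉ A) : ∃ b', b' ≠ b ∧ b' ∉ A ∧ ∀ φ ∈ Δ, ∀ (v : Fin n → M) (xs : Fin φ.1 → M),
      (∀ i, v i ∈ insert b A) → (∀ i, xs i ∈ insert b A) →
      (φ.2.Realize v xs ↔ φ.2.Realize (Function.update id b b' ∘ v)
        (Function.update id b b' ∘ xs)) := by
  set p := A.card with hp
  let a : Fin p → M := fun i => (A.equivFin.symm i : M)
  have haA : ∀ i, a i ∈ A := fun i => (A.equivFin.symm i).2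
  have hab : ∀ i, b ≠ a i := fun i h => hb (h ▸ haA i)
  have hsurj : ∀ x ∈ insert b A, ∃ j : Fin (p + 1), (Fin.snoc a b : Fin (p + 1) → M) j = x := by
    intro x hx
    rcases Finset.mem_insert.1 hx with rfl | hx
    · exact ⟨Fin.last p, by simp⟩
    · exact ⟨Fin.castSucc (A.equivFin ⟨x, hx⟩), by simp [a]⟩
  let ι := Σ φ : Δ, (Fin n → Fin (p + 1)) × (Fin φ.1.1 → Fin (p + 1))
  let ψ : ι → L.Formula (Fin (p + 1)) := fun t =>
    (t.1.1.2.toFormula).relabel (Sum.elim t.2.1 t.2.2)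
  have hψ : ∀ (t : ι) (y : Fin (p + 1) → M),
      (ψ t).Realize y ↔ t.1.1.2.Realize (y ∘ t.2.1) (y ∘ t.2.2) := by
    intro t y
    simp only [ψ, Formula.realize_relabel, BoundedFormula.realize_toFormula]
    rfl
  let θ : L.Formula (Fin (p + 1)) := Formula.iInf fun t : ι =>
    if (ψ t).Realize (Fin.snoc a b : Fin (p + 1) → M) then ψ t else (ψ t).not
  have hθ : θ.Realize (Fin.snoc a b : Fin (p + 1) → M) := by
    simp only [θ, Formula.realize_iInf]
    intro t
    split_ifs with h
    · exact h
    · exact Formula.realize_not.2 h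
  obtain ⟨b', hb'b, hb'a, hb'⟩ := hdcl p θ a b hab hθ
  refine ⟨b', hb'b, fun h => ?_, ?_⟩
  · exact hb'a (A.equivFin ⟨b', h⟩) (by simp [a])
  · intro φ hφ v xs hv hxs
    choose v' hv' using fun i => hsurj (v i) (hv i)
    choose xs' hxs' using fun i => hsurj (xs i) (hxs i)
    have hrepl : ∀ j, Function.update id b b' ((Fin.snoc a b : Fin (p + 1) → M) j) =
        (Fin.snoc a b' : Fin (p + 1) → M) j := by
      intro j
      refine Fin.lastCases ?_ (fun i => ?_) j
      · simp
      · simp [Function.update_of_ne (hab i).symm]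
    have e1 : v = (Fin.snoc a b : Fin (p + 1) → M) ∘ v' := funext fun i => (hv' i).symm
    have e2 : xs = (Fin.snoc a b : Fin (p + 1) → M) ∘ xs' := funext fun i => (hxs' i).symm
    have e3 : Function.update id b b' ∘ v = (Fin.snoc a b' : Fin (p + 1) → M) ∘ v' := by
      rw [e1]; funext i; exact hrepl _
    have e4 : Function.update id b b' ∘ xs = (Fin.snoc a b' : Fin (p + 1) → M) ∘ xs' := by
      rw [e2]; funext i; exact hrepl _
    rw [e3, e4, e1, e2]
    have := Formula.realize_iInf.1 hb' ⟨⟨φ, hφ⟩, v', xs'⟩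
    rw [← hψ ⟨⟨φ, hφ⟩, v', xs'⟩, ← hψ ⟨⟨φ, hφ⟩, v', xs'⟩]
    split_ifs at this with h
    · exact ⟨fun _ => this, fun _ => h⟩
    · exact ⟨fun h' => absurd h' h, fun h' => absurd h' (Formula.realize_not.1 this)⟩

open Classical in
lemma exists_dup (hdcl : TrivDcl L M) (Δ : Finset (AllF L n)) (B : Finset M) :
    ∃ d : M → M, (∀ b ∈ B, d b ∉ B) ∧ Set.InjOn d B ∧
      ∀ φ ∈ Δ, ∀ g : M → M, (∀ b ∈ B, g b = b ∨ g b = d b) →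
        ∀ (v : Fin n → M) (xs : Fin φ.1 → M), (∀ i, v i ∈ B) → (∀ i, xs i ∈ B) →
          (φ.2.Realize v xs ↔ φ.2.Realize (g ∘ v) (g ∘ xs)) := by
  suffices h : ∀ S ⊆ B, ∃ d : M → M, (∀ b ∈ S, d b ∉ B) ∧ Set.InjOn d S ∧
      ∀ φ ∈ Δ, ∀ g : M → M, (∀ b ∈ B, g b = b ∨ (b ∈ S ∧ g b = d b)) →
        ∀ (v : Fin n → M) (xs : Fin φ.1 → M), (∀ i, v i ∈ B) → (∀ i, xs i ∈ B) →
          (φ.2.Realize v xs ↔ φ.2.Realize (g ∘ v) (g ∘ xs)) by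
    obtain ⟨d, h1, h2, h3⟩ := h B subset_rfl
    exact ⟨d, h1, h2, fun φ hφ g hg => h3 φ hφ g fun b hb => (hg b hb).imp_right fun h => ⟨hb, h⟩⟩
  intro S
  induction S using Finset.induction_on with
  | empty =>
    intro _
    refine ⟨id, by simp, by simp, fun φ _ g hg v xs hv hxs => ?_⟩
    have e1 : g ∘ v = v := funext fun i => by simpa using hg _ (hv i)
    have e2 : g ∘ xs = xs := funext fun i => by simpa using hg _ (hxs i)
    rw [e1, e2]
  | insert b S hbS ih =>
    intro hSB
    have hbB : b ∈ B := hSB (Finset.mem_insert_self b S)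
    have hS : S ⊆ B := fun x hx => hSB (Finset.mem_insert_of_mem hx)
    obtain ⟨d, hd1, hd2, hd3⟩ := ih hS
    obtain ⟨b', hb'b, hb'A, hb'⟩ := exists_twin hdcl Δ ((B ∪ S.image d).erase b) b (by simp)
    have hins : insert b ((B ∪ S.image d).erase b) = B ∪ S.image d :=
      Finset.insert_erase (Finset.mem_union_left _ hbB)
    rw [hins] at hb'
    have hb'n : b' ∉ B ∪ S.image d := fun h => hb'A (Finset.mem_erase.2 ⟨hb'b, h⟩)
    have hne : ∀ x ∈ S, x ≠ b := fun x hx h => hbS (h ▸ hx)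
    refine ⟨Function.update d b b', ?_, ?_, ?_⟩
    · intro x hx
      rcases Finset.mem_insert.1 hx with rfl | hx
      · simpa using fun h => hb'n (Finset.mem_union_left _ h)
      · rw [Function.update_of_ne (hne x hx)]; exact hd1 x hx
    · intro x hx y hy hxy
      rw [Finset.mem_coe, Finset.mem_insert] at hx hy
      rcases hx with rfl | hx <;> rcases hy with rfl | hy
      · rfl
      · rw [Function.update_self, Function.update_of_ne (hne y hy)] at hxy
        exact absurd (Finset.mem_union_right _ (Finset.mem_image.2 ⟨y, hy, hxy.symm⟩)) hb'n
      · rw [Function.update_self, Function.update_of_ne (hne x hx)] at hxy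
        exact absurd (Finset.mem_union_right _ (Finset.mem_image.2 ⟨x, hx, hxy⟩)) hb'n
      · rw [Function.update_of_ne (hne x hx), Function.update_of_ne (hne y hy)] at hxy
        exact hd2 hx hy hxy
    · intro φ hφ g hg v xs hv hxs
      let g₁ : M → M := Function.update g b b
      have hg₁ : ∀ x ∈ B, g₁ x = x ∨ (x ∈ S ∧ g₁ x = d x) := by
        intro x hx
        by_cases hxb : x = b
        · subst hxb; simp [g₁]
        · have := hg x hx
          simpa [g₁, Function.update_of_ne hxb, hxb] using this
      rw [hd3 φ hφ g₁ hg₁ v xs hv hxs]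
      have hg₁mem : ∀ x ∈ B, g₁ x ∈ B ∪ S.image d := by
        intro x hx
        rcases hg₁ x hx with h | ⟨h, h'⟩
        · rw [h]; exact Finset.mem_union_left _ hx
        · rw [h']; exact Finset.mem_union_right _ (Finset.mem_image_of_mem d h)
      by_cases hgb : g b = b
      · have : g₁ = g := by
          have := Function.update_eq_self b g
          rwa [hgb] at this
        rw [this]
      · have hgb' : g b = b' := by
          rcases hg b hbB with h | ⟨_, h⟩
          · exact absurd h hgb
          · simpa using h
        rw [hb' φ hφ (g₁ ∘ v) (g₁ ∘ xs) (fun i => hg₁mem _ (hv i)) (fun i => hg₁mem _ (hxs i))]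
        have hcomp : ∀ x ∈ B, Function.update id b b' (g₁ x) = g x := by
          intro x hx
          by_cases hxb : x = b
          · subst hxb; simp [g₁, hgb']
          · have h1 : g₁ x = g x := by simp [g₁, Function.update_of_ne hxb]
            have h2 : g₁ x ≠ b := by
              rcases hg₁ x hx with h | ⟨h, h'⟩
              · rw [h]; exact hxb
              · rw [h']; exact fun h'' => hd1 x h (h'' ▸ hbB)
            rw [Function.update_of_ne h2, h1]; rfl
        have e1 : Function.update id b b' ∘ g₁ ∘ v = g ∘ v := funext fun i => hcomp _ (hv i)
        have e2 : Function.update id b b' ∘ g₁ ∘ xs = g ∘ xs := funext fun i => hcomp _ (hxs i)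
        rw [e1, e2]

/-- An increasing sequence of finite subsets of `M`, in which every element of `B k` has a twin
`d k` with respect to the formulas in `Δ k`, and new elements `c k` supply witnesses. -/
structure Tower (L : FirstOrder.Language.{0,0}) (M : Type) [L.Structure M] (n : ℕ) where
  B : ℕ → Finset M
  d : ℕ → M → M
  c : ℕ → M → M
  Δ : ℕ → Finset (AllF L n)
  B_subset : ∀ k, B k ⊆ B (k + 1)
  d_mem : ∀ k, ∀ b ∈ B k, d k b ∈ B (k + 1)
  c_mem : ∀ k y, c k y ∈ B (k + 1)
  d_notMem : ∀ k, ∀ b ∈ B k, d k b ∉ B k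
  d_injOn : ∀ k, Set.InjOn (d k) (B k)
  preserves : ∀ k, ∀ φ ∈ Δ k, ∀ g : M → M, (∀ b ∈ B k, g b = b ∨ g b = d k b) →
    ∀ (v : Fin n → M) (xs : Fin φ.1 → M), (∀ i, v i ∈ B k) → (∀ i, xs i ∈ B k) →
      (φ.2.Realize v xs ↔ φ.2.Realize (g ∘ v) (g ∘ xs))
  witness : ∀ k l (φ : L.BoundedFormula (Fin n) (l + 1)), ⟨l + 1, φ⟩ ∈ Δ k →
    ∀ (v : Fin n → M) (xs : Fin l → M),
      (∀ i, v i ∈ B k ∨ ∃ b ∈ B k, v i = d k b) → (∀ i, xs i ∈ B k ∨ ∃ b ∈ B k, xs i = d k b) →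
      (∃ y, (∀ i, y ≠ v i) ∧ (∀ i, y ≠ xs i) ∧ ¬ φ.Realize v (Fin.snoc xs y)) →
      ∃ u, (∀ i, c k u ≠ v i) ∧ (∀ i, c k u ≠ xs i) ∧ ¬ φ.Realize v (Fin.snoc xs (c k u))
  Δ_mono : ∀ k, Δ k ⊆ Δ (k + 1)
  Δ_exhaust : ∀ φ, ∃ k, φ ∈ Δ k
  separates : ∀ k (v w : Fin n → M), (∀ i, v i ∈ B k) → (∀ i, w i ∈ B k) →
    (∃ φ : L.Formula (Fin n), φ.Realize v ∧ ¬ φ.Realize w) →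
    ∃ φ : L.Formula (Fin n), (⟨0, φ⟩ : AllF L n) ∈ Δ k ∧ φ.Realize v ∧ ¬ φ.Realize w

open Classical in
lemma exists_step [Nonempty M] (hdcl : TrivDcl L M) (Δ : Finset (AllF L n)) (B : Finset M) :
    ∃ (d c : M → M) (B' : Finset M), B ⊆ B' ∧ (∀ b ∈ B, d b ∈ B') ∧ (∀ y, c y ∈ B') ∧
      (∀ b ∈ B, d b ∉ B) ∧ Set.InjOn d B ∧
      (∀ φ ∈ Δ, ∀ g : M → M, (∀ b ∈ B, g b = b ∨ g b = d b) →
        ∀ (v : Fin n → M) (xs : Fin φ.1 → M), (∀ i, v i ∈ B) → (∀ i, xs i ∈ B) →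
          (φ.2.Realize v xs ↔ φ.2.Realize (g ∘ v) (g ∘ xs))) ∧
      (∀ l (φ : L.BoundedFormula (Fin n) (l + 1)), ⟨l + 1, φ⟩ ∈ Δ →
        ∀ (v : Fin n → M) (xs : Fin l → M),
        (∀ i, v i ∈ B ∨ ∃ b ∈ B, v i = d b) → (∀ i, xs i ∈ B ∨ ∃ b ∈ B, xs i = d b) →
        (∃ y, (∀ i, y ≠ v i) ∧ (∀ i, y ≠ xs i) ∧ ¬ φ.Realize v (Fin.snoc xs y)) →
        ∃ u, (∀ i, c u ≠ v i) ∧ (∀ i, c u ≠ xs i) ∧ ¬ φ.Realize v (Fin.snoc xs (c u))) := by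
  obtain ⟨d, hd1, hd2, hd3⟩ := exists_dup hdcl Δ B
  set B₁ := B ∪ B.image d with hB₁
  have hB₁mem : ∀ x, (x ∈ B ∨ ∃ b ∈ B, x = d b) → x ∈ B₁ := by
    rintro x (h | ⟨b, hb, rfl⟩)
    · exact Finset.mem_union_left _ h
    · exact Finset.mem_union_right _ (Finset.mem_image_of_mem d hb)
  let Q : (Σ l, L.BoundedFormula (Fin n) (l + 1)) → AllF L n := fun p => ⟨p.1 + 1, p.2⟩
  have hQ : Function.Injective Q := by
    rintro ⟨l, φ⟩ ⟨l', φ'⟩ h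
    obtain rfl : l = l' := by simpa [Q] using congrArg Sigma.fst h
    simpa [Q] using h
  have : Finite (Q ⁻¹' (Δ : Set (AllF L n))) := Δ.finite_toSet.preimage hQ.injOn
  let ι := Σ p : Q ⁻¹' (Δ : Set (AllF L n)), (Fin n → B₁) × (Fin p.1.1 → B₁)
  let good : ι → M → Prop := fun t y => (∀ i, y ≠ t.2.1 i) ∧ (∀ i, y ≠ t.2.2 i) ∧
    ¬ t.1.1.2.Realize (fun i => (t.2.1 i : M)) (Fin.snoc (fun i => (t.2.2 i : M)) y)
  let W : ι → M := fun t => Classical.epsilon (good t)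
  have hWfin : (Set.range W).Finite := Set.finite_range W
  obtain ⟨m₀⟩ := ‹Nonempty M›
  let c : M → M := fun y => if y ∈ hWfin.toFinset then y else m₀
  refine ⟨d, c, insert m₀ (B₁ ∪ hWfin.toFinset), ?_, ?_, ?_, hd1, hd2, hd3, ?_⟩
  · exact fun x hx => Finset.mem_insert_of_mem (Finset.mem_union_left _ (hB₁mem x (Or.inl hx)))
  · exact fun b hb => Finset.mem_insert_of_mem
      (Finset.mem_union_left _ (hB₁mem _ (Or.inr ⟨b, hb, rfl⟩)))
  · intro y
    simp only [c]
    split_ifs with h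
    · exact Finset.mem_insert_of_mem (Finset.mem_union_right _ h)
    · exact Finset.mem_insert_self _ _
  · intro l φ hφ v xs hv hxs hy
    let t : ι := ⟨⟨⟨l, φ⟩, hφ⟩, fun i => ⟨v i, hB₁mem _ (hv i)⟩, fun i => ⟨xs i, hB₁mem _ (hxs i)⟩⟩
    have hg : good t (W t) := Classical.epsilon_spec (p := good t) hy
    have hc : c (W t) = W t := if_pos (hWfin.mem_toFinset.2 ⟨t, rfl⟩)
    exact ⟨W t, by rw [hc]; exact hg⟩

open Classical in
lemma exists_tower [Nonempty M] [Countable (AllF L n)] (hdcl : TrivDcl L M) (B₀ : Finset M)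
    (φ₀ : AllF L n) : ∃ t : Tower L M n, t.B 0 = B₀ ∧ φ₀ ∈ t.Δ 0 := by
  have : Nonempty (AllF L n) := ⟨φ₀⟩
  obtain ⟨e, he⟩ := exists_surjective_nat (AllF L n)
  have hσ : ∀ v w : Fin n → M, ∃ φ : L.Formula (Fin n),
      (∃ φ : L.Formula (Fin n), φ.Realize v ∧ ¬ φ.Realize w) → φ.Realize v ∧ ¬ φ.Realize w := by
    intro v w
    by_cases h : ∃ φ : L.Formula (Fin n), φ.Realize v ∧ ¬ φ.Realize w
    · exact ⟨h.choose, fun _ => h.choose_spec⟩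
    · exact ⟨⊥, fun h' => absurd h' h⟩
  choose σ hσ using hσ
  let sep : Finset M → Finset (AllF L n) := fun B =>
    (Finset.univ : Finset ((Fin n → B) × (Fin n → B))).image fun p =>
      ⟨0, σ (fun i => p.1 i) (fun i => p.2 i)⟩
  have hsep : ∀ (B : Finset M) (v w : Fin n → M), (∀ i, v i ∈ B) → (∀ i, w i ∈ B) →
      (⟨0, σ v w⟩ : AllF L n) ∈ sep B := by
    intro B v w hv hw
    exact Finset.mem_image.2 ⟨⟨fun i => ⟨v i, hv i⟩, fun i => ⟨w i, hw i⟩⟩, Finset.mem_univ _, rfl⟩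
  have hsepmono : ∀ B B' : Finset M, B ⊆ B' → sep B ⊆ sep B' := by
    intro B B' h x hx
    obtain ⟨p, -, rfl⟩ := Finset.mem_image.1 hx
    exact hsep B' _ _ (fun i => h (p.1 i).2) (fun i => h (p.2 i).2)
  let Del : ℕ → Finset M → Finset (AllF L n) := fun k B =>
    insert φ₀ ((Finset.range (k + 1)).image e ∪ sep B)
  choose d c nxt h1 h2 h3 h4 h5 h6 h7 using
    fun (Δ : Finset (AllF L n)) (B : Finset M) => exists_step hdcl Δ B
  let B : ℕ → Finset M := fun k => Nat.rec B₀ (fun k B => nxt (Del k B) B) k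
  refine ⟨⟨B, fun k => d (Del k (B k)) (B k), fun k => c (Del k (B k)) (B k),
    fun k => Del k (B k), fun k => h1 _ _, fun k => h2 _ _, fun k => h3 _ _, fun k => h4 _ _,
    fun k => h5 _ _, fun k => h6 _ _, fun k => h7 _ _, ?_, ?_, ?_⟩, rfl, ?_⟩
  · intro k
    refine Finset.insert_subset_insert _ (Finset.union_subset_union ?_ (hsepmono _ _ (h1 _ _)))
    exact Finset.image_subset_image (Finset.range_subset_range.2 (by omega))
  · intro φ
    obtain ⟨k, rfl⟩ := he φ
    exact ⟨k, Finset.mem_insert_of_mem (Finset.mem_union_left _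
      (Finset.mem_image_of_mem e (Finset.self_mem_range_succ k)))⟩
  · intro k v w hv hw h
    exact ⟨σ v w, Finset.mem_insert_of_mem (Finset.mem_union_right _ (hsep _ v w hv hw)), hσ v w h⟩
  · exact Finset.mem_insert_self _ _

end ModelTheory

section Limit

variable {L} {M : Type} [L.Structure M] {n : ℕ}

namespace Tower

variable (t : Tower L M n) (Y : ℕ → ℕ → M)

/-- From stage `K` on, the `i`-th sequence stays in `B k` and moves only along `d k`. -/
def Tracks (K i : ℕ) : Prop :=
  ∀ k, K ≤ k → Y k i ∈ t.B k ∧ (Y (k + 1) i = Y k i ∨ Y (k + 1) i = t.d k (Y k i))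

/-- The sequences indexed by `S` are tracked from stage `K` on, and distinct at stage `K`. -/
def Settled (S : Finset ℕ) (K : ℕ) : Prop :=
  (∀ i ∈ S, t.Tracks Y K i) ∧ Set.InjOn (Y K) S

/-- A family of sequences that is rich enough to have a limit structure. -/
structure Rich : Prop where
  tracks : ∀ i, ∃ K, t.Tracks Y K i
  separated : ∀ i j, i ≠ j → ∃ K, t.Tracks Y K i ∧ t.Tracks Y K j ∧ Y K i ≠ Y K j
  witnessed : ∀ k u, ∃ j, Y (k + 1) j = t.c k u ∧ t.Tracks Y (k + 1) j

variable {t Y}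

lemma Tracks.mono {K K' i : ℕ} (h : t.Tracks Y K i) (hK : K ≤ K') : t.Tracks Y K' i :=
  fun k hk => h k (hK.trans hk)

lemma Tracks.ne_succ {K i j : ℕ} (hi : t.Tracks Y K i) (hj : t.Tracks Y K j)
    (h : Y K i ≠ Y K j) : Y (K + 1) i ≠ Y (K + 1) j := by
  obtain ⟨hiB, hi'⟩ := hi K le_rfl
  obtain ⟨hjB, hj'⟩ := hj K le_rfl
  rcases hi' with hi' | hi' <;> rcases hj' with hj' | hj' <;> rw [hi', hj']
  · exact h
  · exact fun e => t.d_notMem K _ hjB (e ▸ hiB)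
  · exact fun e => t.d_notMem K _ hiB (e ▸ hjB)
  · exact fun e => h (t.d_injOn K hiB hjB e)

lemma Settled.succ {S : Finset ℕ} {K : ℕ} (h : t.Settled Y S K) : t.Settled Y S (K + 1) := by
  refine ⟨fun i hi => (h.1 i hi).mono (Nat.le_succ K), fun i hi j hj hij => ?_⟩
  by_contra hne
  exact (h.1 i hi).ne_succ (h.1 j hj) (fun e => hne (h.2 hi hj e)) hij

lemma Settled.mono {S : Finset ℕ} {K k : ℕ} (h : t.Settled Y S K) (hk : K ≤ k) :
    t.Settled Y S k := by
  induction k, hk using Nat.le_induction with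
  | base => exact h
  | succ k _ ih => exact ih.succ

lemma Δ_le {k k' : ℕ} (h : k ≤ k') : t.Δ k ⊆ t.Δ k' := by
  induction k', h using Nat.le_induction with
  | base => exact subset_rfl
  | succ k _ ih => exact ih.trans (t.Δ_mono k)

open Classical in
lemma Settled.realize_succ {S : Finset ℕ} {K l : ℕ} (h : t.Settled Y S K)
    {φ : L.BoundedFormula (Fin n) l} (hφ : (⟨l, φ⟩ : AllF L n) ∈ t.Δ K) {v : Fin n → ℕ}
    {xs : Fin l → ℕ} (hv : ∀ i, v i ∈ S) (hxs : ∀ i, xs i ∈ S) :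
    φ.Realize (Y K ∘ v) (Y K ∘ xs) ↔ φ.Realize (Y (K + 1) ∘ v) (Y (K + 1) ∘ xs) := by
  let g : M → M := fun b => if hb : ∃ i ∈ S, Y K i = b then Y (K + 1) hb.choose else b
  have hg : ∀ i ∈ S, g (Y K i) = Y (K + 1) i := by
    intro i hi
    have hb : ∃ j ∈ S, Y K j = Y K i := ⟨i, hi, rfl⟩
    have he : hb.choose = i := h.2 hb.choose_spec.1 hi hb.choose_spec.2
    simp only [g, dif_pos hb, he]
  have hsel : ∀ b ∈ t.B K, g b = b ∨ g b = t.d K b := by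
    intro b _
    by_cases hb : ∃ i ∈ S, Y K i = b
    · obtain ⟨i, hi, rfl⟩ := hb
      rw [hg i hi]
      exact (h.1 i hi K le_rfl).2
    · exact Or.inl (dif_neg hb)
  have e1 : Y (K + 1) ∘ v = g ∘ (Y K ∘ v) := funext fun i => (hg _ (hv i)).symm
  have e2 : Y (K + 1) ∘ xs = g ∘ (Y K ∘ xs) := funext fun i => (hg _ (hxs i)).symm
  rw [e1, e2]
  exact t.preserves K _ hφ g hsel _ _ (fun i => (h.1 _ (hv i) K le_rfl).1)
    (fun i => (h.1 _ (hxs i) K le_rfl).1)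

lemma Settled.realize_iff {S : Finset ℕ} {K k l : ℕ} (h : t.Settled Y S K) (hk : K ≤ k)
    {φ : L.BoundedFormula (Fin n) l} (hφ : (⟨l, φ⟩ : AllF L n) ∈ t.Δ K) {v : Fin n → ℕ}
    {xs : Fin l → ℕ} (hv : ∀ i, v i ∈ S) (hxs : ∀ i, xs i ∈ S) :
    φ.Realize (Y K ∘ v) (Y K ∘ xs) ↔ φ.Realize (Y k ∘ v) (Y k ∘ xs) := by
  induction k, hk using Nat.le_induction with
  | base => rfl
  | succ k hk ih => rw [ih, (h.mono hk).realize_succ (Δ_le hk hφ) hv hxs]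

lemma Rich.exists_settled (h : t.Rich Y) (S : Finset ℕ) : ∃ K, t.Settled Y S K := by
  classical
  choose K₁ hK₁ using h.tracks
  choose! K₂ hK₂ using h.separated
  refine ⟨(S.sup K₁) ⊔ (S ×ˢ S).sup fun p => K₂ p.1 p.2, fun i hi => (hK₁ i).mono ?_, ?_⟩
  · exact (Finset.le_sup hi).trans le_sup_left
  · intro i hi j hj hij
    by_contra hne
    obtain ⟨h1, h2, h3⟩ := hK₂ i j hne
    have hs : t.Settled Y {i, j} (K₂ i j) := by
      refine ⟨by simp [h1, h2], ?_⟩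
      intro a ha b hb hab
      simp only [Finset.coe_insert, Finset.coe_singleton, Set.mem_insert_iff,
        Set.mem_singleton_iff] at ha hb
      rcases ha with rfl | rfl <;> rcases hb with rfl | rfl
      · rfl
      · exact absurd hab h3
      · exact absurd hab.symm h3
      · rfl
    have hle : K₂ i j ≤ (S.sup K₁) ⊔ (S ×ˢ S).sup fun p => K₂ p.1 p.2 :=
      (Finset.le_sup (f := fun p : ℕ × ℕ => K₂ p.1 p.2)
        (Finset.mk_mem_product hi hj)).trans le_sup_right
    exact hne ((hs.mono hle).2 (by simp) (by simp) hij)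

/-- The finite set of indices occurring in two tuples. -/
abbrev indices {l : ℕ} (v : Fin n → ℕ) (xs : Fin l → ℕ) : Finset ℕ :=
  Finset.univ.image v ∪ Finset.univ.image xs

lemma Rich.eventually_settled (h : t.Rich Y) (S : Finset ℕ) (φ : AllF L n) :
    ∀ᶠ k in Filter.atTop, t.Settled Y S k ∧ φ ∈ t.Δ k := by
  obtain ⟨K, hK⟩ := h.exists_settled S
  obtain ⟨K', hK'⟩ := t.Δ_exhaust φ
  filter_upwards [Filter.eventually_ge_atTop K, Filter.eventually_ge_atTop K'] with k h1 h2
  exact ⟨hK.mono h1, Δ_le h2 hK'⟩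

lemma Rich.eventually_or (h : t.Rich Y) {l : ℕ} (φ : L.BoundedFormula (Fin n) l) (v : Fin n → ℕ)
    (xs : Fin l → ℕ) : (∀ᶠ k in Filter.atTop, φ.Realize (Y k ∘ v) (Y k ∘ xs)) ∨
      ∀ᶠ k in Filter.atTop, ¬ φ.Realize (Y k ∘ v) (Y k ∘ xs) := by
  obtain ⟨K, hK, hφ⟩ := (h.eventually_settled (indices v xs) ⟨l, φ⟩).exists
  have hst : ∀ k, K ≤ k → _ := fun k hk => hK.realize_iff hk hφ (v := v) (xs := xs)
    (by simp) (by simp)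
  by_cases hr : φ.Realize (Y K ∘ v) (Y K ∘ xs)
  · left
    filter_upwards [Filter.eventually_ge_atTop K] with k hk
    exact (hst k hk).1 hr
  · right
    filter_upwards [Filter.eventually_ge_atTop K] with k hk
    exact fun h' => hr ((hst k hk).2 h')

lemma Rich.not_eventually_iff (h : t.Rich Y) {l : ℕ} (φ : L.BoundedFormula (Fin n) l)
    (v : Fin n → ℕ) (xs : Fin l → ℕ) : (¬ ∀ᶠ k in Filter.atTop, φ.Realize (Y k ∘ v) (Y k ∘ xs)) ↔
      ∀ᶠ k in Filter.atTop, ¬ φ.Realize (Y k ∘ v) (Y k ∘ xs) := by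
  refine ⟨fun h' => (h.eventually_or φ v xs).resolve_left h', fun h1 h2 => ?_⟩
  obtain ⟨k, hk⟩ := (h1.and h2).exists
  exact hk.1 hk.2

lemma Rich.eventually_eq_iff (h : t.Rich Y) (i j : ℕ) :
    (∀ᶠ k in Filter.atTop, Y k i = Y k j) ↔ i = j := by
  refine ⟨fun h' => ?_, fun h' => by simp [h']⟩
  obtain ⟨K, hK⟩ := h.exists_settled {i, j}
  obtain ⟨k, hk, hk'⟩ := (h'.and (Filter.eventually_ge_atTop K)).exists
  exact (hK.mono hk').2 (by simp) (by simp) hk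

/-- Truth in the limit structure is eventual truth. -/
theorem Rich.realize_iff [L.IsRelational] [L.Structure ℕ] (h : t.Rich Y)
    (hrel : ∀ (l : ℕ) (R : L.Relations l) (a : Fin l → ℕ),
      Structure.RelMap R a ↔ ∀ᶠ k in Filter.atTop, Structure.RelMap R (Y k ∘ a))
    {l : ℕ} (φ : L.BoundedFormula (Fin n) l) (v : Fin n → ℕ) (xs : Fin l → ℕ) :
    φ.Realize v xs ↔ ∀ᶠ k in Filter.atTop, φ.Realize (Y k ∘ v) (Y k ∘ xs) := by
  have hterm : ∀ {l : ℕ} (s : L.Term (Fin n ⊕ Fin l)) (xs : Fin l → ℕ) (k : ℕ),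
      s.realize (Sum.elim (Y k ∘ v) (Y k ∘ xs)) = Y k (s.realize (Sum.elim v xs)) := by
    intro l s xs k
    cases s with
    | var i => cases i <;> rfl
    | func f _ => exact isEmptyElim f
  induction φ with
  | falsum => simp only [BoundedFormula.Realize, Filter.eventually_const]
  | equal s₁ s₂ =>
    simp only [BoundedFormula.Realize, hterm]
    rw [h.eventually_eq_iff]
  | rel R ts =>
    simp only [BoundedFormula.Realize, hterm]
    exact hrel _ _ _
  | imp φ ψ ih₁ ih₂ =>
    simp only [BoundedFormula.realize_imp, ih₁, ih₂]
    constructor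
    · intro himp
      rcases h.eventually_or φ v xs with h1 | h1
      · filter_upwards [himp h1] with k hk _ using hk
      · filter_upwards [h1] with k hk hk' using absurd hk' hk
    · intro himp h1
      filter_upwards [himp, h1] with k hk hk' using hk hk'
  | @all l φ ih =>
    have hsnoc : ∀ (j k : ℕ), Y k ∘ (Fin.snoc xs j : Fin (l + 1) → ℕ) =
        Fin.snoc (Y k ∘ xs) (Y k j) := fun j k => Fin.comp_snoc _ _ _
    simp only [BoundedFormula.realize_all, ih, hsnoc]
    constructor
    · intro hall
      by_contra hcon
      have hcon' := (h.not_eventually_iff φ.all v xs).1 hcon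
      have hfin : ∀ᶠ k in Filter.atTop, ∀ j ∈ indices v xs,
          φ.Realize (Y k ∘ v) (Fin.snoc (Y k ∘ xs) (Y k j)) :=
        (Filter.eventually_all_finset _).2 fun j _ => hall j
      obtain ⟨K₁, hK₁⟩ := Filter.eventually_atTop.1 (hcon'.and hfin)
      obtain ⟨k, ⟨hset, hφ⟩, hk₁⟩ := ((h.eventually_settled (indices v xs) ⟨l + 1, φ⟩).and
        (Filter.eventually_ge_atTop K₁)).exists
      obtain ⟨hnall, hidx⟩ := hK₁ (k + 1) (by omega)
      rw [BoundedFormula.realize_all] at hnall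
      push Not at hnall
      obtain ⟨y, hy⟩ := hnall
      have hne : ∀ j ∈ indices v xs, y ≠ Y (k + 1) j := by
        rintro j hj rfl
        exact hy (hidx j hj)
      have hmem : ∀ j ∈ indices v xs, Y (k + 1) j ∈ t.B k ∨ ∃ b ∈ t.B k, Y (k + 1) j = t.d k b := by
        intro j hj
        obtain ⟨h1, h2 | h2⟩ := hset.1 j hj k le_rfl
        · exact Or.inl (h2 ▸ h1)
        · exact Or.inr ⟨_, h1, h2⟩
      have hvmem : ∀ i, v i ∈ indices v xs := by simp
      have hxmem : ∀ i, xs i ∈ indices v xs := by simp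
      obtain ⟨u, hu1, hu2, hu3⟩ := t.witness k l φ hφ (Y (k + 1) ∘ v) (Y (k + 1) ∘ xs)
        (fun i => hmem _ (hvmem i)) (fun i => hmem _ (hxmem i))
        ⟨y, fun i => hne _ (hvmem i), fun i => hne _ (hxmem i), hy⟩
      obtain ⟨j, hj, hjt⟩ := h.witnessed k u
      have hset' : t.Settled Y (insert j (indices v xs)) (k + 1) := by
        refine ⟨fun i hi => ?_, ?_⟩
        · rcases Finset.mem_insert.1 hi with rfl | hi
          · exact hjt
          · exact hset.succ.1 i hi
        · have hjne : ∀ i ∈ indices v xs, Y (k + 1) j ≠ Y (k + 1) i := by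
            intro i hi
            rcases Finset.mem_union.1 hi with hi | hi
            · obtain ⟨i, -, rfl⟩ := Finset.mem_image.1 hi
              exact hj ▸ hu1 i
            · obtain ⟨i, -, rfl⟩ := Finset.mem_image.1 hi
              exact hj ▸ hu2 i
          intro a ha b hb hab
          rw [Finset.mem_coe] at ha hb
          rcases Finset.mem_insert.1 ha with rfl | ha' <;>
            rcases Finset.mem_insert.1 hb with rfl | hb'
          · rfl
          · exact absurd hab (hjne b hb')
          · exact absurd hab.symm (hjne a ha')
          · exact hset.succ.2 ha' hb' hab
      obtain ⟨K₂, hK₂⟩ := Filter.eventually_atTop.1 (hall j)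
      have h1 := hK₂ (K₂ ⊔ (k + 1)) le_sup_left
      rw [← hsnoc] at h1
      rw [← hset'.realize_iff le_sup_right (t.Δ_mono k hφ)
        (fun i => Finset.mem_insert_of_mem (hvmem i)) ?_, hsnoc, hj] at h1
      · exact hu3 h1
      · intro i
        refine Fin.lastCases ?_ (fun i => ?_) i
        · simp
        · rw [Fin.snoc_castSucc]; exact Finset.mem_insert_of_mem (hxmem i)
    · intro hall j
      filter_upwards [hall] with k hk using hk _

/-- Disjoint tuples satisfying a rooted formula have different limit types. -/
lemma Rich.exists_formula_ne (h : t.Rich Y) {χ : L.Formula (Fin n)}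
    (hroot : ∀ v w : Fin n → M, χ.Realize v →
      (∀ φ : L.Formula (Fin n), φ.Realize v ↔ φ.Realize w) → ∃ i j, v i = w j)
    {v w : Fin n → ℕ} (hvw : ∀ i j, v i ≠ w j)
    (hv : ∀ᶠ k in Filter.atTop, χ.Realize (Y k ∘ v)) :
    ∃ φ : L.Formula (Fin n), (∀ᶠ k in Filter.atTop, φ.Realize (Y k ∘ v)) ∧
      ¬ ∀ᶠ k in Filter.atTop, φ.Realize (Y k ∘ w) := by
  obtain ⟨K, ⟨hK, -⟩, hχ⟩ := ((h.eventually_settled (indices v w) ⟨0, χ⟩).and hv).exists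
  have hvm : ∀ i, v i ∈ indices v w := by simp
  have hwm : ∀ i, w i ∈ indices v w := by simp
  have hdiff : ∃ φ : L.Formula (Fin n), φ.Realize (Y K ∘ v) ∧ ¬ φ.Realize (Y K ∘ w) := by
    by_contra hcon
    push Not at hcon
    obtain ⟨i, j, hij⟩ := hroot (Y K ∘ v) (Y K ∘ w) hχ fun φ => by
      refine ⟨hcon φ, fun hw => ?_⟩
      by_contra hnv
      have := hcon φ.not (Formula.realize_not.2 hnv)
      exact (Formula.realize_not.1 this) hw
    exact hvw i j (hK.2 (hvm i) (hwm j) hij)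
  obtain ⟨φ, hφ, h1, h2⟩ := t.separates K (Y K ∘ v) (Y K ∘ w)
    (fun i => (hK.1 _ (hvm i) K le_rfl).1) (fun i => (hK.1 _ (hwm i) K le_rfl).1) hdiff
  have key : ∀ u : Fin n → ℕ, (∀ i, u i ∈ indices v w) → ∀ k, K ≤ k →
      (φ.Realize (Y K ∘ u) ↔ φ.Realize (Y k ∘ u)) := by
    intro u hu k hk
    have := hK.realize_iff hk hφ (v := u) (xs := default) hu (fun i => i.elim0)
    simp only [Formula.Realize]
    convert this using 2
  refine ⟨φ, ?_, fun h' => ?_⟩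
  · filter_upwards [Filter.eventually_ge_atTop K] with k hk using (key v hvm k hk).1 h1
  · obtain ⟨k, hk, hk'⟩ := (h'.and (Filter.eventually_ge_atTop K)).exists
    exact h2 ((key w hwm k hk').2 hk)

end Tower

end Limit

section Dynamics

variable {L} {M : Type} [L.Structure M] {n : ℕ}

instance optionMeasurableSpace {M : Type} : MeasurableSpace (Option M) := ⊤

instance optionDiscrete {M : Type} : DiscreteMeasurableSpace (Option M) := ⟨fun _ => trivial⟩

/-- An initial state together with a sequence of instructions. -/
abbrev Seed (M : Type) : Type := Option M × (ℕ → Option M)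

namespace Tower

variable (t : Tower L M n)

/-- One step of the process: from the blank state `none`, enter the tower at a new element or stay
blank; from `b`, stay at `b` or move to its twin. -/
def step (k : ℕ) : Option M → Option M → Option M
  | none, u => u.map (t.c k)
  | some b, none => some b
  | some b, some _ => some (t.d k b)

/-- The state at stage `k` of the process driven by a seed. -/
def state (s : Seed M) : ℕ → Option M
  | 0 => s.1
  | k + 1 => t.step k (state s k) (s.2 k)

/-- The current element of each process, with a default value for blank states. -/
noncomputable def current [Nonempty M] (ω : ℕ → Seed M) (k i : ℕ) : M :=
  (t.state (ω i) k).getD (Classical.arbitrary M)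

open Classical in
/-- The limit structure determined by a sequence of seeds. -/
noncomputable def limit [Nonempty M] (ω : ℕ → Seed M) : StrL L := fun _ R a =>
  decide (∀ᶠ k in Filter.atTop, Structure.RelMap R (t.current ω k ∘ a))

/-- The almost sure properties of a sequence of seeds. -/
structure Generic (ω : ℕ → Seed M) : Prop where
  start : ∀ i, (ω i).1 = none ∨ ∃ b ∈ t.B 0, (ω i).1 = some b
  enters : ∀ i, ∃ k, (ω i).2 k ≠ none
  splits : ∀ i j, i ≠ j → ∀ K, ∃ k, K ≤ k ∧ ¬ ((ω i).2 k = none ↔ (ω j).2 k = none)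
  late : ∀ k u, ∃ j, (ω j).1 = none ∧ (∀ i < k, (ω j).2 i = none) ∧ (ω j).2 k = some u

variable {t}

lemma state_mem {s : Seed M} (h : s.1 = none ∨ ∃ b ∈ t.B 0, s.1 = some b) (k : ℕ) :
    ∀ b, t.state s k = some b → b ∈ t.B k := by
  induction k with
  | zero =>
    intro b hb
    rcases h with h | ⟨b', hb', h⟩
    · simp [state, h] at hb
    · simp only [state, h, Option.some.injEq] at hb
      exact hb ▸ hb'
  | succ k ih =>
    intro b hb
    rw [state] at hb
    cases hs : t.state s k with
    | none =>
      rw [hs] at hb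
      obtain ⟨u, -, rfl⟩ := Option.map_eq_some_iff.1 hb
      exact t.c_mem k u
    | some b' =>
      rw [hs] at hb
      cases hu : s.2 k with
      | none =>
        rw [hu] at hb
        obtain rfl : b' = b := by simpa [step] using hb
        exact t.B_subset k (ih _ hs)
      | some u =>
        rw [hu] at hb
        obtain rfl : t.d k b' = b := by simpa [step] using hb
        exact t.d_mem k _ (ih _ hs)

lemma state_succ_of_some {s : Seed M} {k : ℕ} {b : M} (h : t.state s k = some b) :
    t.state s (k + 1) = some (if s.2 k = none then b else t.d k b) := by
  rw [state, h]
  cases hu : s.2 k <;> simp [step]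

lemma state_ne_none {s : Seed M} {K k : ℕ} (h : t.state s K ≠ none) (hk : K ≤ k) :
    t.state s k ≠ none := by
  induction k, hk using Nat.le_induction with
  | base => exact h
  | succ k _ ih =>
    obtain ⟨b, hb⟩ := Option.ne_none_iff_exists'.1 ih
    rw [state_succ_of_some hb]
    simp

lemma state_eq_none {s : Seed M} {k : ℕ} (h0 : s.1 = none) (h : ∀ i < k, s.2 i = none) :
    t.state s k = none := by
  induction k with
  | zero => exact h0
  | succ k ih => simp [state, ih fun i hi => h i (hi.trans (Nat.lt_succ_self k)), h k, step]

lemma exists_state_ne_none {s : Seed M} (h : ∃ k, s.2 k ≠ none) : ∃ k, t.state s k ≠ none := by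
  obtain ⟨k, hk⟩ := h
  by_contra! hcon
  have := hcon (k + 1)
  rw [state, hcon k] at this
  simp only [step, Option.map_eq_none_iff] at this
  exact hk this

lemma measurable_state [Countable M] (k : ℕ) : Measurable fun s : Seed M => t.state s k := by
  induction k with
  | zero => exact measurable_fst
  | succ k ih =>
    have h : Measurable fun p : Option M × Option M => t.step k p.1 p.2 := measurable_of_countable _
    exact h.comp (ih.prodMk ((measurable_pi_apply k).comp measurable_snd))

section

variable [Nonempty M] {ω : ℕ → Seed M}

lemma state_eq_current {k i : ℕ} (h : t.state (ω i) k ≠ none) :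
    t.state (ω i) k = some (t.current ω k i) := by
  obtain ⟨b, hb⟩ := Option.ne_none_iff_exists'.1 h
  simp [current, hb]

lemma current_succ {k i : ℕ} (h : t.state (ω i) k ≠ none) :
    t.current ω (k + 1) i =
      if (ω i).2 k = none then t.current ω k i else t.d k (t.current ω k i) := by
  have := state_succ_of_some (state_eq_current h)
  rw [state_eq_current (state_ne_none h (Nat.le_succ k))] at this
  exact Option.some_injective _ this

lemma tracks_of_ne_none {K i : ℕ} (hi : (ω i).1 = none ∨ ∃ b ∈ t.B 0, (ω i).1 = some b)
    (hK : t.state (ω i) K ≠ none) : t.Tracks (t.current ω) K i := by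
  intro k hk
  have hs := state_ne_none hK hk
  refine ⟨state_mem hi k _ (state_eq_current hs), ?_⟩
  rw [current_succ hs]
  split_ifs
  · exact Or.inl rfl
  · exact Or.inr rfl

lemma Generic.tracks_of_ne_none (h : t.Generic ω) {K i : ℕ} (hK : t.state (ω i) K ≠ none) :
    t.Tracks (t.current ω) K i :=
  Tower.tracks_of_ne_none (h.start i) hK

lemma Generic.rich (h : t.Generic ω) : t.Rich (t.current ω) where
  tracks i := by
    obtain ⟨K, hK⟩ := exists_state_ne_none (t := t) (h.enters i)
    exact ⟨K, h.tracks_of_ne_none hK⟩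
  separated i j hij := by
    obtain ⟨K₁, hK₁⟩ := exists_state_ne_none (t := t) (h.enters i)
    obtain ⟨K₂, hK₂⟩ := exists_state_ne_none (t := t) (h.enters j)
    obtain ⟨k, hk, hsplit⟩ := h.splits i j hij (K₁ ⊔ K₂)
    have hi := state_ne_none hK₁ (le_sup_left.trans hk)
    have hj := state_ne_none hK₂ (le_sup_right.trans hk)
    have hti := h.tracks_of_ne_none hi
    have htj := h.tracks_of_ne_none hj
    refine ⟨k + 1, hti.mono (Nat.le_succ k), htj.mono (Nat.le_succ k), ?_⟩
    by_cases he : t.current ω k i = t.current ω k j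
    · have hd := t.d_notMem k _ (htj k le_rfl).1
      rw [current_succ hi, current_succ hj, he]
      intro heq
      split_ifs at heq with h1 h2 h2
      · exact hsplit ⟨fun _ => h2, fun _ => h1⟩
      · exact hd (heq ▸ (htj k le_rfl).1)
      · exact hd (heq.symm ▸ (htj k le_rfl).1)
      · exact hsplit ⟨fun h' => absurd h' h1, fun h' => absurd h' h2⟩
    · exact hti.ne_succ htj he
  witnessed k u := by
    obtain ⟨j, h0, h1, h2⟩ := h.late k u
    have hs : t.state (ω j) (k + 1) = some (t.c k u) := by
      rw [state, state_eq_none h0 h1, h2]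
      rfl
    refine ⟨j, ?_, h.tracks_of_ne_none (by simp [hs])⟩
    simp [current, hs]

/-- In the limit of a generic sequence, truth is eventual truth. -/
theorem Generic.satF_iff [L.IsRelational] (h : t.Generic ω) (φ : L.Formula (Fin n))
    (v : Fin n → ℕ) :
    SatF L (t.limit ω) φ v ↔ ∀ᶠ k in Filter.atTop, φ.Realize (t.current ω k ∘ v) := by
  let _ : L.Structure ℕ := toStructure L (t.limit ω)
  have hr : ∀ (l : ℕ) (R : L.Relations l) (a : Fin l → ℕ), Structure.RelMap R a ↔
      ∀ᶠ k in Filter.atTop, Structure.RelMap R (t.current ω k ∘ a) := fun l R a => by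
    change t.limit ω l R a = true ↔ _
    simp only [limit, decide_eq_true_eq]
  change φ.Realize v ↔ _
  rw [Formula.Realize, h.rich.realize_iff hr]
  simp only [Formula.Realize]
  refine Filter.eventually_congr (Filter.Eventually.of_forall fun k => ?_)
  convert Iff.rfl using 2

lemma limit_comp (σ : Equiv.Perm ℕ) (ω : ℕ → Seed M) :
    t.limit (fun i => ω (σ i)) = act L σ.symm (t.limit ω) := rfl

variable [Countable M]

lemma measurableSet_current {l : ℕ} (p : (Fin l → M) → Prop) (k : ℕ) :
    MeasurableSet {s : Fin l → Seed M |
      p fun i => (t.state (s i) k).getD (Classical.arbitrary M)} := by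
  let q : Set (Fin l → Option M) := {f | p fun i => (f i).getD (Classical.arbitrary M)}
  have hq : MeasurableSet q := Set.to_countable q |>.measurableSet
  have hm : Measurable fun (s : Fin l → Seed M) i => t.state (s i) k :=
    measurable_pi_lambda _ fun i => (measurable_state k).comp (measurable_pi_apply i)
  exact hm hq

lemma measurableSet_eventually {l : ℕ} (p : (Fin l → M) → Prop) :
    MeasurableSet {s : Fin l → Seed M | ∀ᶠ k in Filter.atTop,
      p fun i => (t.state (s i) k).getD (Classical.arbitrary M)} := by
  simp only [Filter.eventually_atTop]
  have : {s : Fin l → Seed M | ∃ K, ∀ k, K ≤ k →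
      p fun i => (t.state (s i) k).getD (Classical.arbitrary M)} =
      ⋃ K, ⋂ k, ⋂ (_ : K ≤ k), {s : Fin l → Seed M |
        p fun i => (t.state (s i) k).getD (Classical.arbitrary M)} := by
    ext s; simp
  rw [this]
  exact MeasurableSet.iUnion fun K => MeasurableSet.iInter fun k => MeasurableSet.iInter fun _ =>
    measurableSet_current p k

lemma measurable_limit : Measurable (t.limit : (ℕ → Seed M) → StrL L) := by
  refine measurable_pi_lambda _ fun l => measurable_pi_lambda _ fun R =>
    measurable_pi_lambda _ fun a => ?_
  refine measurable_to_bool ?_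
  have h := measurable_comp_index a
    (measurableSet_eventually (t := t) fun v : Fin l → M => Structure.RelMap R v)
  convert h using 1
  ext ω
  simp only [Set.mem_preimage, Set.mem_singleton_iff, limit, decide_eq_true_eq]
  rfl

end

end Tower

end Dynamics

section Satisfaction

variable {L} [L.IsRelational] {n : ℕ}

lemma realize_iff_of_relMap_iff {N N' : Type} [L.Structure N] [L.Structure N'] (e : N ≃ N')
    (he : ∀ (l : ℕ) (R : L.Relations l) (a : Fin l → N),
      Structure.RelMap R (e ∘ a) ↔ Structure.RelMap R a)
    (φ : L.Formula (Fin n)) (v : Fin n → N) : φ.Realize (e ∘ v) ↔ φ.Realize v :=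
  StrongHomClass.realize_formula (F := N ≃[L] N')
    { e with map_fun' := fun f _ => isEmptyElim f, map_rel' := fun R a => he _ R a } φ

lemma satF_act_iff (σ : Equiv.Perm ℕ) (x : StrL L) (φ : L.Formula (Fin n)) (v : Fin n → ℕ) :
    SatF L (act L σ x) φ (σ ∘ v) ↔ SatF L x φ v := by
  refine @realize_iff_of_relMap_iff L _ n ℕ ℕ (toStructure L x) (toStructure L (act L σ x)) σ
    (fun l R a => ?_) φ v
  change x l R (fun i => σ.symm (σ (a i))) = true ↔ x l R a = true
  simp

lemma measurableSet_realize {l : ℕ} (φ : L.BoundedFormula (Fin n) l) (v : Fin n → ℕ)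
    (xs : Fin l → ℕ) :
    MeasurableSet {x : StrL L | @BoundedFormula.Realize L ℕ (toStructure L x) _ _ φ v xs} := by
  have hterm : ∀ {l : ℕ} (s : L.Term (Fin n ⊕ Fin l)) (xs : Fin l → ℕ), ∃ a : ℕ, ∀ x : StrL L,
      @Term.realize L ℕ (toStructure L x) _ (Sum.elim v xs) s = a := by
    intro l s xs
    cases s with
    | var i => exact ⟨Sum.elim v xs i, fun _ => rfl⟩
    | func f _ => exact isEmptyElim f
  induction φ with
  | falsum => exact MeasurableSet.empty
  | equal s₁ s₂ =>
    obtain ⟨a₁, h₁⟩ := hterm s₁ xs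
    obtain ⟨a₂, h₂⟩ := hterm s₂ xs
    simp only [BoundedFormula.Realize, h₁, h₂]
    exact MeasurableSet.const _
  | rel R ts =>
    choose a ha using fun i => hterm (ts i) xs
    simp only [BoundedFormula.Realize, ha]
    have hm : Measurable fun x : StrL L => x _ R a :=
      (measurable_pi_apply a).comp ((measurable_pi_apply R).comp (measurable_pi_apply _))
    exact hm (measurableSet_singleton true)
  | imp φ ψ ih₁ ih₂ => exact (ih₁ xs).imp (ih₂ xs)
  | all φ ih =>
    simp only [BoundedFormula.Realize, Set.ofPred_forall]
    exact MeasurableSet.iInter fun j => ih _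

lemma measurableSet_satF (φ : L.Formula (Fin n)) (v : Fin n → ℕ) :
    MeasurableSet {x : StrL L | SatF L x φ v} :=
  measurableSet_realize φ v (@default _ Unique.instInhabited)

end Satisfaction

section AlmostSure

variable {L} {M : Type} [L.Structure M] {n : ℕ}

/-- The law of a seed with initial state distributed according to `w` and independent
instructions distributed according to `q`. -/
noncomputable abbrev seedLaw (w q : Measure (Option M)) [IsProbabilityMeasure q] :
    Measure (Seed M) :=
  w.prod (Measure.infinitePi fun _ : ℕ => q)

lemma iid_eval_null {Ω : Type} [MeasurableSpace Ω] (m : Measure Ω) [IsProbabilityMeasure m]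
    {A : Set Ω} (h : m A = 0) (i : ℕ) : iid m {ω | ω i ∈ A} = 0 :=
  (measurePreserving_eval_infinitePi (fun _ : ℕ => m) i).quasiMeasurePreserving.preimage_null h

variable (w q : Measure (Option M)) [IsProbabilityMeasure w] [IsProbabilityMeasure q]

lemma ae_exists_of_pos {Ω : Type} [MeasurableSpace Ω] (m : Measure Ω) [IsProbabilityMeasure m]
    {A : Set Ω} (hA : MeasurableSet A) (h : m A ≠ 0) : ∀ᵐ ω ∂iid m, ∃ j, ω j ∈ A := by
  have hlt : m Aᶜ < 1 := by
    rw [prob_compl_eq_one_sub hA]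
    exact ENNReal.sub_lt_self ENNReal.one_ne_top one_ne_zero h
  have h0 := infinitePi_box_eq_zero m (fun _ => Aᶜ) (fun _ => hA.compl) hlt (fun _ => le_rfl) 0
  rw [ae_iff]
  convert h0 using 2
  ext ω
  simp

lemma ae_enters (hq : ∀ u, q {u} ≠ 0) [Nonempty M] (i : ℕ) :
    ∀ᵐ ω ∂iid (seedLaw w q), ∃ k, (ω i).2 k ≠ none := by
  have h0 : Measure.infinitePi (fun _ : ℕ => q) {x | ∀ k, 0 ≤ k → x k ∈ ({none} : Set (Option M))}
      = 0 := by
    refine infinitePi_box_eq_zero q (fun _ => {none}) (fun _ => measurableSet_singleton _)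
      (ρ := q {none}) ?_ (fun _ => le_rfl) 0
    refine lt_of_le_of_ne prob_le_one fun h1 => hq (some (Classical.arbitrary M)) ?_
    have := (prob_compl_eq_zero_iff (measurableSet_singleton (none : Option M))).2 h1
    exact measure_mono_null (by simp) this
  have h1 : seedLaw w q (Prod.snd ⁻¹' {x | ∀ k, 0 ≤ k → x k ∈ ({none} : Set (Option M))}) = 0 :=
    Measure.quasiMeasurePreserving_snd.preimage_null h0
  rw [ae_iff]
  convert iid_eval_null _ h1 i using 2
  ext ω
  simp

lemma ae_splits (hq : ∀ u, q {u} ≠ 0) [Nonempty M] {i j : ℕ} (hij : i ≠ j) (K : ℕ) :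
    ∀ᵐ ω ∂iid (seedLaw w q), ∃ k, K ≤ k ∧ ¬ ((ω i).2 k = none ↔ (ω j).2 k = none) := by
  set Q := Measure.infinitePi (fun _ : ℕ => q) with hQ
  have hnone : q {none} < 1 := by
    refine lt_of_le_of_ne prob_le_one fun h1 => hq (some (Classical.arbitrary M)) ?_
    have := (prob_compl_eq_zero_iff (measurableSet_singleton (none : Option M))).2 h1
    exact measure_mono_null (by simp) this
  have hsome : q {none}ᶜ < 1 := by
    rw [prob_compl_eq_one_sub (measurableSet_singleton _)]
    exact ENNReal.sub_lt_self ENNReal.one_ne_top one_ne_zero (hq none)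
  have hslice : ∀ x : ℕ → Option M, Q {y | ∀ k, K ≤ k → (x k = none ↔ y k = none)} = 0 := by
    intro x
    refine infinitePi_box_eq_zero q (fun k => {u | x k = none ↔ u = none})
      (fun _ => MeasurableSet.of_discrete) (max_lt hnone hsome) (fun k => ?_) K
    by_cases hx : x k = none
    · refine le_trans (measure_mono fun u hu => ?_) (le_max_left _ _)
      exact hu.1 hx
    · refine le_trans (measure_mono fun u hu => ?_) (le_max_right _ _)
      exact fun h => hx (hu.2 h)
  let D : Set (Seed M × Seed M) := {p | ∀ k, K ≤ k → (p.1.2 k = none ↔ p.2.2 k = none)}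
  have hc : ∀ k, Measurable fun p : Seed M × Seed M => (p.1.2 k, p.2.2 k) := fun k =>
    ((measurable_pi_apply k).comp (measurable_snd.comp measurable_fst)).prodMk
      ((measurable_pi_apply k).comp (measurable_snd.comp measurable_snd))
  have hD : MeasurableSet D := by
    have : D = ⋂ k, ⋂ (_ : K ≤ k), {p | p.1.2 k = none ↔ p.2.2 k = none} := by
      ext p; simp [D]
    rw [this]
    refine MeasurableSet.iInter fun k => MeasurableSet.iInter fun _ => ?_
    have h1 : MeasurableSet {p : Seed M × Seed M | p.1.2 k = none} :=
      (measurable_fst.comp (hc k)) (measurableSet_singleton none)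
    have h2 : MeasurableSet {p : Seed M × Seed M | p.2.2 k = none} :=
      (measurable_snd.comp (hc k)) (measurableSet_singleton none)
    exact h1.iff h2
  have hnull : ((seedLaw w q).prod (seedLaw w q)) D = 0 := by
    rw [Measure.measure_prod_null hD]
    refine Filter.Eventually.of_forall fun s => ?_
    exact Measure.quasiMeasurePreserving_snd.preimage_null (hslice s.2)
  have hind := ((ProbabilityTheory.iIndepFun_infinitePi (P := fun _ : ℕ => seedLaw w q)
    (X := fun _ x => x) (fun _ => measurable_id)).indepFun hij)
  rw [ProbabilityTheory.indepFun_iff_map_prod_eq_prod_map_map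
    (measurable_pi_apply i).aemeasurable (measurable_pi_apply j).aemeasurable,
    Measure.infinitePi_map_eval, Measure.infinitePi_map_eval] at hind
  rw [← hind, Measure.map_apply ((measurable_pi_apply i).prodMk (measurable_pi_apply j)) hD] at hnull
  rw [ae_iff]
  convert hnull using 2
  ext ω
  simp [D]

lemma ae_late (hw : w {none} ≠ 0) (hq : ∀ u, q {u} ≠ 0) (k : ℕ) (u : M) :
    ∀ᵐ ω ∂iid (seedLaw w q), ∃ j, (ω j).1 = none ∧ (∀ i < k, (ω j).2 i = none) ∧
      (ω j).2 k = some u := by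
  let s : ℕ → Set (Option M) := fun i => if i < k then {none} else {some u}
  let A : Set (Seed M) := {none} ×ˢ Set.pi (Finset.range (k + 1)) s
  have hs : ∀ i, MeasurableSet (s i) := fun i => MeasurableSet.of_discrete
  have hA : MeasurableSet A := (measurableSet_singleton _).prod
    (MeasurableSet.pi (Finset.countable_toSet _) fun i _ => hs i)
  have hpos : seedLaw w q A ≠ 0 := by
    rw [Measure.prod_prod, Measure.infinitePi_pi (fun _ : ℕ => q) fun i _ => hs i]
    refine mul_ne_zero hw (Finset.prod_ne_zero_iff.2 fun i _ => ?_)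
    simp only [s]
    split_ifs <;> exact hq _
  filter_upwards [ae_exists_of_pos _ hA hpos] with ω hω
  obtain ⟨j, h0, h1⟩ := hω
  refine ⟨j, h0, fun i hi => ?_, ?_⟩
  · have := h1 i (by simp; omega)
    simpa [s, hi] using this
  · have := h1 k (by simp)
    simpa [s] using this

namespace Tower

variable (t : Tower L M n) [Countable M] [Nonempty M]

theorem ae_generic (hw : w {none} ≠ 0) (hwB : w {x | ¬ (x = none ∨ ∃ b ∈ t.B 0, x = some b)} = 0)
    (hq : ∀ u, q {u} ≠ 0) : ∀ᵐ ω ∂iid (seedLaw w q), t.Generic ω := by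
  have h0 : ∀ᵐ ω ∂iid (seedLaw w q), ∀ i, (ω i).1 = none ∨ ∃ b ∈ t.B 0, (ω i).1 = some b := by
    rw [ae_all_iff]
    intro i
    rw [ae_iff]
    exact iid_eval_null (seedLaw w q) (Measure.quasiMeasurePreserving_fst.preimage_null hwB) i
  have h1 : ∀ᵐ ω ∂iid (seedLaw w q), ∀ i, ∃ k, (ω i).2 k ≠ none :=
    ae_all_iff.2 fun i => ae_enters w q hq i
  have h2 : ∀ᵐ ω ∂iid (seedLaw w q), ∀ i j, i ≠ j → ∀ K, ∃ k, K ≤ k ∧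
      ¬ ((ω i).2 k = none ↔ (ω j).2 k = none) := by
    refine ae_all_iff.2 fun i => ae_all_iff.2 fun j => ?_
    by_cases hij : i = j
    · exact Filter.Eventually.of_forall fun ω h => absurd hij h
    · filter_upwards [ae_all_iff.2 fun K => ae_splits w q hq hij K] with ω hω _ using hω
  have h3 : ∀ᵐ ω ∂iid (seedLaw w q), ∀ k u, ∃ j, (ω j).1 = none ∧ (∀ i < k, (ω j).2 i = none) ∧
      (ω j).2 k = some u :=
    ae_all_iff.2 fun k => ae_all_iff.2 fun u => ae_late w q hw hq k u
  filter_upwards [h0, h1, h2, h3] with ω a b c d using ⟨a, b, c, d⟩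

/-- The law of the limit structure. -/
noncomputable def law : Measure (StrL L) := (iid (seedLaw w q)).map t.limit

lemma law_isErgodicStructure : IsErgodicStructure L (t.law w q) :=
  iid_map_isErgodicStructure _ t.measurable_limit fun σ ω => t.limit_comp σ ω

variable [L.IsRelational] {w q}

variable {t} in
omit [Countable M] in
lemma Generic.satS {ω : ℕ → Seed M} (h : t.Generic ω) {φ : L.Sentence} (hφ : M ⊨ φ) :
    SatS L (t.limit ω) φ := by
  have key : ∀ (N : Type) [L.Structure N] (v : Fin n → N),
      Formula.Realize (φ.relabel (Empty.elim : Empty → Fin n)) v ↔ N ⊨ φ := by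
    intro N _ v
    rw [Formula.realize_relabel, Sentence.Realize]
    congr!
  let _ : L.Structure ℕ := toStructure L (t.limit ω)
  refine (key ℕ (fun _ => 0)).1 ((h.satF_iff _ _).2 ?_)
  exact Filter.Eventually.of_forall fun k => (key M _).2 hφ

lemma law_extS (hgen : ∀ᵐ ω ∂iid (seedLaw w q), t.Generic ω) {φ : L.Sentence} (hφ : M ⊨ φ) :
    t.law w q (extS L φ) = 1 := by
  have : IsProbabilityMeasure (t.law w q) := (t.law_isErgodicStructure w q).1
  refine le_antisymm prob_le_one ?_
  have h1 : iid (seedLaw w q) (t.limit ⁻¹' extS L φ) = 1 := by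
    rw [← measure_univ (μ := iid (seedLaw w q))]
    refine measure_congr (Filter.eventuallyEq_univ.2 ?_)
    filter_upwards [hgen] with ω hω using hω.satS hφ
  rw [← h1]
  exact Measure.le_map_apply t.measurable_limit.aemeasurable _

lemma law_orbitsNull [Countable (L.Formula (Fin n))]
    (hgen : ∀ᵐ ω ∂iid (seedLaw w q), t.Generic ω) {χ : L.Formula (Fin n)}
    (hroot : ∀ v w : Fin n → M, χ.Realize v →
      (∀ φ : L.Formula (Fin n), φ.Realize v ↔ φ.Realize w) → ∃ i j, v i = w j)
    (hχ : ∀ ω, t.Generic ω → ∃ v, SatF L (t.limit ω) χ v) : OrbitsNull L (t.law w q) := by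
  intro N
  have hlim := t.measurable_limit
  by_cases hN : ∃ a, SatF L N χ a
  · obtain ⟨a, ha⟩ := hN
    let E : (Fin n → ℕ) → Set (StrL L) := fun b => {x | ∀ φ, SatF L N φ a ↔ SatF L x φ b}
    have hsub : IsoClass L N ⊆ ⋃ b, E b := by
      rintro x ⟨σ, rfl⟩
      exact Set.mem_iUnion.2 ⟨σ ∘ a, fun φ => (satF_act_iff σ N φ a).symm⟩
    have hE : ∀ b, MeasurableSet (E b) := by
      intro b
      simp only [E, Set.ofPred_forall]
      exact MeasurableSet.iInter fun φ => (MeasurableSet.const _).iff (measurableSet_satF φ b)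
    refine measure_mono_null hsub (measure_iUnion_null fun b => ?_)
    let A : Set (Fin n → Seed M) := {s | ∀ φ : L.Formula (Fin n), SatF L N φ a ↔
      ∀ᶠ k in Filter.atTop, φ.Realize fun i => (t.state (s i) k).getD (Classical.arbitrary M)}
    have hA : MeasurableSet A := by
      simp only [A, Set.ofPred_forall]
      exact MeasurableSet.iInter fun φ => (MeasurableSet.const _).iff
        (measurableSet_eventually fun v => φ.Realize v)
    rw [law, Measure.map_apply hlim (hE b)]
    have hEA : iid (seedLaw w q) (t.limit ⁻¹' E b) =
        iid (seedLaw w q) {ω | (fun i => ω (b i)) ∈ A} := by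
      refine measure_congr ?_
      filter_upwards [hgen] with ω hω
      refine propext (forall_congr' fun φ => ?_)
      rw [hω.satF_iff]
      rfl
    rw [hEA]
    obtain ⟨σ, hσ⟩ := exists_perm_ge (Finset.univ.sup b + 1)
    have hlt : ∀ i, b i < Finset.univ.sup b + 1 := fun i =>
      Nat.lt_succ_of_le (Finset.le_sup (Finset.mem_univ i))
    have hdisj : ∀ i j, b i ≠ σ (b j) := fun i j =>
      ((hlt i).trans_le (hσ _ (hlt j))).ne
    have hprod := iid_inter_comp_of_disjoint (seedLaw w q) b (σ ∘ b) hdisj hA hA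
    have hsame : iid (seedLaw w q) {ω | (fun i => ω ((σ ∘ b) i)) ∈ A} =
        iid (seedLaw w q) {ω | (fun i => ω (b i)) ∈ A} := by
      have hb : MeasurableSet {ω : ℕ → Seed M | (fun i => ω (b i)) ∈ A} :=
        measurable_comp_index b hA
      conv_rhs => rw [← iid_reindex (seedLaw w q) σ, Measure.map_apply (measurable_comp_index _) hb]
      rfl
    have hzero : iid (seedLaw w q) ({ω | (fun i => ω (b i)) ∈ A} ∩
        {ω | (fun i => ω ((σ ∘ b) i)) ∈ A}) = 0 := by
      refine measure_mono_null (fun ω hω => ?_) hgen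
      intro hg
      have hω1 : ∀ φ : L.Formula (Fin n), SatF L N φ a ↔
        ∀ᶠ k in Filter.atTop, φ.Realize (t.current ω k ∘ b) := hω.1
      have hω2 : ∀ φ : L.Formula (Fin n), SatF L N φ a ↔
        ∀ᶠ k in Filter.atTop, φ.Realize (t.current ω k ∘ (σ ∘ b)) := hω.2
      obtain ⟨φ, h1, h2⟩ := hg.rich.exists_formula_ne hroot hdisj ((hω1 χ).1 ha)
      exact h2 ((hω2 φ).1 ((hω1 φ).2 h1))
    rw [hzero, hsame] at hprod
    exact mul_self_eq_zero.1 hprod.symm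
  · have hsub : IsoClass L N ⊆ ⋂ v, {x | SatF L x χ v}ᶜ := by
      rintro x ⟨σ, rfl⟩
      refine Set.mem_iInter.2 fun v hv => hN ⟨σ.symm ∘ v, ?_⟩
      rw [← satF_act_iff σ]
      simpa [Function.comp_def] using hv
    refine measure_mono_null hsub ?_
    rw [law, Measure.map_apply hlim
      (MeasurableSet.iInter fun v => (measurableSet_satF χ v).compl)]
    refine measure_mono_null (fun ω hω => ?_) hgen
    intro hg
    obtain ⟨v, hv⟩ := hχ ω hg
    exact Set.mem_iInter.1 hω v hv

end Tower

end AlmostSure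

section Polynomial

variable {S : Type} [Fintype S] {n : ℕ}

/-- The positive probability vectors on `S`. -/
def posSimplex (S : Type) [Fintype S] : Set (S → ℝ) := {x | (∀ s, 0 < x s) ∧ ∑ s, x s = 1}

lemma posSimplex_convex : Convex ℝ (posSimplex S) := by
  intro x hx y hy a b ha hb hab
  refine ⟨fun s => ?_, ?_⟩
  · simp only [Pi.add_apply, Pi.smul_apply, smul_eq_mul]
    have h1 := hx.1 s
    have h2 := hy.1 s
    rcases ha.eq_or_lt with rfl | ha
    · simpa using mul_pos (by linarith : 0 < b) h2
    · exact add_pos_of_pos_of_nonneg (mul_pos ha h1) (mul_nonneg hb h2.le)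
  · simp [Finset.sum_add_distrib, ← Finset.mul_sum, hx.2, hy.2, hab]

omit [Fintype S] in
lemma sum_single_apply [DecidableEq S] (f : Fin n → S) (s : S) :
    (∑ i, Finsupp.single (f i) 1 : S →₀ ℕ) s = (Finset.univ.filter fun i => f i = s).card := by
  rw [Finset.card_filter, Finsupp.finsetSum_apply]
  simp only [Finsupp.single_apply]

omit [Fintype S] in
lemma injective_of_sum_single_eq {f a : Fin n → S} (ha : Function.Injective a)
    (h : (∑ i, Finsupp.single (f i) 1 : S →₀ ℕ) = ∑ i, Finsupp.single (a i) 1) :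
    Function.Injective f ∧ ∀ i, f i ∈ Set.range a := by
  classical
  have hcard : ∀ s, (Finset.univ.filter fun i => f i = s).card =
      (Finset.univ.filter fun i => a i = s).card := fun s => by
    simpa only [sum_single_apply] using DFunLike.congr_fun h s
  refine ⟨fun i j hij => ?_, fun i => ?_⟩
  · have hle : (Finset.univ.filter fun k => f k = f j).card ≤ 1 := by
      rw [hcard, Finset.card_le_one]
      intro x hx y hy
      exact ha (by rw [(Finset.mem_filter.1 hx).2, (Finset.mem_filter.1 hy).2])
    exact Finset.card_le_one.1 hle i (by simp [hij]) j (by simp)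
  · have hpos : 0 < (Finset.univ.filter fun k => a k = f i).card := by
      rw [← hcard]
      exact Finset.card_pos.2 ⟨i, by simp⟩
    obtain ⟨k, hk⟩ := Finset.card_pos.1 hpos
    exact ⟨k, (Finset.mem_filter.1 hk).2⟩

lemma exists_ne_on_posSimplex {ν : (Fin n → S) → ℝ} (hν : ∀ f, 0 ≤ ν f) {a a' : Fin n → S}
    (ha : Function.Injective a)
    (h0 : ∀ f, Function.Injective f → (∀ i, f i ∈ Set.range a) → ν f = 0) (h1 : 0 < ν a') [Nonempty S] :
    ∃ x ∈ posSimplex S, ∃ y ∈ posSimplex S,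
      ∑ f : Fin n → S, (∏ i, x (f i)) * ν f < ∑ f : Fin n → S, (∏ i, y (f i)) * ν f := by
  classical
  by_contra! hcon
  have hconst : ∃ c : ℝ, ∀ x ∈ posSimplex S, ∑ f : Fin n → S, (∏ i, x (f i)) * ν f = c := by
    by_cases hne : (posSimplex S).Nonempty
    · obtain ⟨y, hy⟩ := hne
      exact ⟨_, fun x hx => le_antisymm (hcon y hy x hx) (hcon x hx y hy)⟩
    · exact ⟨0, fun x hx => absurd ⟨x, hx⟩ hne⟩
  obtain ⟨c, hc⟩ := hconst
  have hhom : ∀ x : S → ℝ, (∀ s, 0 < x s) →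
      ∑ f : Fin n → S, (∏ i, x (f i)) * (ν f - c) = 0 := by
    intro x hx
    have hT : 0 < ∑ s, x s := Finset.sum_pos (fun s _ => hx s) Finset.univ_nonempty
    have hmem : (fun s => x s / ∑ s, x s) ∈ posSimplex S := by
      refine ⟨fun s => div_pos (hx s) hT, ?_⟩
      rw [← Finset.sum_div, div_self hT.ne']
    have hx' := hc _ hmem
    simp only [Finset.prod_div_distrib, Finset.prod_const, Finset.card_univ, Fintype.card_fin,
      div_mul_eq_mul_div] at hx'
    rw [← Finset.sum_div, div_eq_iff (pow_ne_zero _ hT.ne')] at hx'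
    have hpow : (∑ s, x s) ^ n = ∑ f : Fin n → S, ∏ i, x (f i) := by
      have := Finset.prod_univ_sum (fun _ : Fin n => (Finset.univ : Finset S)) fun _ s => x s
      simpa using this
    simp only [mul_sub, Finset.sum_sub_distrib, hx', ← Finset.sum_mul, ← hpow]
    ring
  let p : MvPolynomial S ℝ :=
    ∑ f : Fin n → S, MvPolynomial.monomial (∑ i, Finsupp.single (f i) 1) (ν f - c)
  have hp : p = 0 := by
    refine MvPolynomial.funext_set (fun _ => Set.Ioi 0) (fun _ => Set.Ioi_infinite 0) fun x hx => ?_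
    have := hhom x fun s => hx s (Set.mem_univ s)
    simp only [p, map_sum, map_zero]
    rw [← this]
    refine Finset.sum_congr rfl fun f _ => ?_
    rw [MvPolynomial.monomial_sum_index, map_mul, MvPolynomial.eval_C, map_prod, mul_comm]
    simp [MvPolynomial.eval_monomial]
  have hcoeff : ∀ b : Fin n → S, ∑ f : Fin n → S,
      (if (∑ i, Finsupp.single (f i) 1 : S →₀ ℕ) = ∑ i, Finsupp.single (b i) 1
        then ν f - c else 0) = 0 := by
    intro b
    have := congrArg (MvPolynomial.coeff (∑ i, Finsupp.single (b i) 1)) hp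
    simpa only [p, MvPolynomial.coeff_sum, MvPolynomial.coeff_monomial,
      MvPolynomial.coeff_zero] using this
  have hc0 : c = 0 := by
    have h := hcoeff a
    have hterm : ∀ f : Fin n → S,
        (if (∑ i, Finsupp.single (f i) 1 : S →₀ ℕ) = ∑ i, Finsupp.single (a i) 1
          then ν f - c else 0) =
        (if (∑ i, Finsupp.single (f i) 1 : S →₀ ℕ) = ∑ i, Finsupp.single (a i) 1
          then 1 else 0) * (-c) := by
      intro f
      split_ifs with hf
      · obtain ⟨hinj, hran⟩ := injective_of_sum_single_eq ha hf
        rw [h0 f hinj hran]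
        ring
      · ring
    simp only [hterm, ← Finset.sum_mul] at h
    rcases mul_eq_zero.1 h with h | h
    · have : (1 : ℝ) ≤ ∑ f : Fin n → S,
        (if (∑ i, Finsupp.single (f i) 1 : S →₀ ℕ) = ∑ i, Finsupp.single (a i) 1
          then 1 else 0) := by
        refine le_trans (by simp) (Finset.single_le_sum (fun f _ => ?_) (Finset.mem_univ a))
        split_ifs <;> simp
      linarith
    · linarith
  have h := hcoeff a'
  have hpos : 0 < ∑ f : Fin n → S,
      (if (∑ i, Finsupp.single (f i) 1 : S →₀ ℕ) = ∑ i, Finsupp.single (a' i) 1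
        then ν f - c else 0) := by
    refine Finset.sum_pos' (fun f _ => ?_) ⟨a', Finset.mem_univ _, ?_⟩
    · split_ifs
      · simpa [hc0] using hν f
      · exact le_rfl
    · simpa [hc0] using h1
  exact hpos.ne' h

lemma continuum_le_image_posSimplex {ν : (Fin n → S) → ℝ} {x y : S → ℝ}
    (hx : x ∈ posSimplex S) (hy : y ∈ posSimplex S)
    (hxy : ∑ f : Fin n → S, (∏ i, x (f i)) * ν f < ∑ f : Fin n → S, (∏ i, y (f i)) * ν f) :
    Cardinal.continuum ≤ Cardinal.mk
      ((fun x : S → ℝ => ∑ f : Fin n → S, (∏ i, x (f i)) * ν f) '' posSimplex S) := by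
  have hcont : Continuous fun x : S → ℝ => ∑ f : Fin n → S, (∏ i, x (f i)) * ν f := by fun_prop
  have hpre := (posSimplex_convex (S := S)).isPreconnected.image _ hcont.continuousOn
  have hsub := hpre.Icc_subset (Set.mem_image_of_mem _ hx) (Set.mem_image_of_mem _ hy)
  rw [← Cardinal.mk_Icc_real hxy]
  exact Cardinal.mk_le_mk_of_subset hsub

end Polynomial

section UpperBound

lemma mk_probabilityMeasure_le {X : Type} [MeasurableSpace X]
    [MeasurableSpace.CountablyGenerated X] (P : Measure X → Prop)
    (hP : ∀ μ, P μ → IsProbabilityMeasure μ) :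
    Cardinal.mk {μ : Measure X // P μ} ≤ Cardinal.continuum := by
  obtain ⟨b, hb, hgen⟩ := MeasurableSpace.CountablyGenerated.isCountablyGenerated (α := X)
  have hA := countable_generateSetAlgebra hb
  let F : {μ : Measure X // P μ} → (generateSetAlgebra b → ℝ) := fun μ s => μ.1.real s
  have hF : Function.Injective F := by
    intro μ ν h
    have := hP _ μ.2
    have := hP _ ν.2
    refine Subtype.ext (ext_of_generate_finite (generateSetAlgebra b) ?_
      (isSetAlgebra_generateSetAlgebra).isSetRing.isSetSemiring.isPiSystem (fun s hs => ?_) (by simp))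
    · rw [generateFrom_generateSetAlgebra_eq, hgen]
    · exact (measureReal_eq_measureReal_iff).1 (congrFun h ⟨s, hs⟩)
  refine (Cardinal.mk_le_of_injective hF).trans ?_
  have : Countable (generateSetAlgebra b) := hA.to_subtype
  rw [← Cardinal.power_def, Cardinal.mk_real]
  exact (Cardinal.power_le_power_left Cardinal.continuum_ne_zero (Cardinal.mk_le_aleph0)).trans
    (by simp)

end UpperBound

section Weights

variable {M S : Type} [Fintype S] {n : ℕ}

/-- The distribution on `Option M` giving weight `x s` to `ι s`. -/
noncomputable def weighted (ι : S → Option M) (x : S → ℝ) : Measure (Option M) :=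
  ∑ s, ENNReal.ofReal (x s) • Measure.dirac (ι s)

lemma weighted_apply (ι : S → Option M) (x : S → ℝ) (A : Set (Option M)) :
    weighted ι x A = ∑ s, ENNReal.ofReal (x s) * Measure.dirac (ι s) A := by
  simp [weighted, Measure.finsetSum_apply]

lemma isProbabilityMeasure_weighted (ι : S → Option M) {x : S → ℝ} (hx : x ∈ posSimplex S) :
    IsProbabilityMeasure (weighted ι x) := by
  refine ⟨?_⟩
  rw [weighted_apply]
  simp only [measure_univ, mul_one]
  rw [← ENNReal.ofReal_sum_of_nonneg fun s _ => (hx.1 s).le, hx.2, ENNReal.ofReal_one]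

lemma weighted_singleton_ne_zero (ι : S → Option M) {x : S → ℝ} (hx : x ∈ posSimplex S) (s : S) :
    weighted ι x {ι s} ≠ 0 := by
  rw [weighted_apply]
  refine (lt_of_lt_of_le ?_ (Finset.single_le_sum (fun _ _ => zero_le) (Finset.mem_univ s))).ne'
  simpa using hx.1 s

lemma weighted_eq_zero (ι : S → Option M) (x : S → ℝ) {A : Set (Option M)} (h : ∀ s, ι s ∉ A) :
    weighted ι x A = 0 := by
  rw [weighted_apply]
  exact Finset.sum_eq_zero fun s _ => by simp [h s]

lemma sum_smul_prod {X Y : Type} [MeasurableSpace X] [MeasurableSpace Y] (c : S → ℝ≥0∞)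
    (m : S → Measure X) [SigmaFinite (∑ s, c s • m s)] (Q : Measure Y) [IsProbabilityMeasure Q] :
    (∑ s, c s • m s).prod Q = ∑ s, c s • (m s).prod Q := by
  refine Measure.prod_eq fun A B hA hB => ?_
  simp only [Measure.finsetSum_apply, Measure.smul_apply, smul_eq_mul, Measure.prod_prod,
    Finset.sum_mul, mul_assoc]

lemma pi_sum_smul {X : Type} [MeasurableSpace X] (c : S → ℝ≥0∞) (m : S → Measure X)
    [∀ s, IsProbabilityMeasure (m s)] [SigmaFinite (∑ s, c s • m s)] :
    Measure.pi (fun _ : Fin n => ∑ s, c s • m s) =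
      ∑ f : Fin n → S, (∏ i, c (f i)) • Measure.pi fun i => m (f i) := by
  classical
  refine Measure.pi_eq fun A hA => ?_
  simp only [Measure.finsetSum_apply, Measure.smul_apply, smul_eq_mul, Measure.pi_pi]
  rw [Finset.prod_univ_sum, Fintype.piFinset_univ]
  simp only [Finset.prod_mul_distrib]

lemma exists_fullSupport (M : Type) [Countable M] : ∃ q : Measure (Option M),
    IsProbabilityMeasure q ∧ ∀ u, q {u} ≠ 0 := by
  have : NeZero (Measure.count : Measure (Option M)) := ⟨fun h => by
    simpa using Measure.count_eq_zero_iff.1 (h ▸ rfl : Measure.count (Set.univ : Set (Option M)) = 0)⟩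
  exact ⟨Measure.count.toFinite, inferInstance, fun u => by simp [toFinite_apply_eq_zero_iff]⟩

end Weights

namespace Tower

variable {L} {M : Type} [L.Structure M] {n : ℕ} {t : Tower L M n} [Nonempty M]

/-- The seeds whose processes eventually satisfy `φ`. -/
def eventualSet (t : Tower L M n) (φ : L.Formula (Fin n)) : Set (Fin n → Seed M) :=
  {s | ∀ᶠ k in Filter.atTop, φ.Realize fun i => (t.state (s i) k).getD (Classical.arbitrary M)}

lemma mem_eventualSet_iff {φ : L.Formula (Fin n)} (hφ : (⟨0, φ⟩ : AllF L n) ∈ t.Δ 0)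
    {b : Fin n → M} (hb : Function.Injective b) (hbB : ∀ i, b i ∈ t.B 0) {s : Fin n → Seed M}
    (hs : ∀ i, (s i).1 = some (b i)) : s ∈ t.eventualSet φ ↔ φ.Realize b := by
  classical
  let ω : ℕ → Seed M := fun j => if h : j < n then s ⟨j, h⟩ else (none, fun _ => none)
  have hω : ∀ i : Fin n, ω i = s i := fun i => by simp [ω]
  have h0 : t.current ω 0 ∘ (fun i : Fin n => (i : ℕ)) = b := by
    funext i
    simp [current, hω, state, hs]
  let S : Finset ℕ := Finset.univ.image fun i : Fin n => (i : ℕ)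
  have hset : t.Settled (t.current ω) S 0 := by
    constructor
    · intro j hj
      obtain ⟨i, -, rfl⟩ := Finset.mem_image.1 hj
      refine tracks_of_ne_none (Or.inr ⟨b i, hbB i, by rw [hω, hs]⟩) ?_
      simp [state, hω, hs]
    · intro j hj j' hj' he
      obtain ⟨i, -, rfl⟩ := Finset.mem_image.1 hj
      obtain ⟨i', -, rfl⟩ := Finset.mem_image.1 hj'
      have h1 := congrFun h0 i
      have h2 := congrFun h0 i'
      simp only [Function.comp_apply] at h1 h2
      rw [hb (h1.symm.trans (he.trans h2))]
  have key : ∀ k, φ.Realize (fun i => (t.state (s i) k).getD (Classical.arbitrary M)) ↔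
      φ.Realize b := by
    intro k
    have := hset.realize_iff (Nat.zero_le k) hφ (v := fun i : Fin n => (i : ℕ))
      (xs := Fin.elim0) (fun i => Finset.mem_image_of_mem _ (Finset.mem_univ i))
      (fun i => i.elim0)
    have e : t.current ω k ∘ (fun i : Fin n => (i : ℕ)) =
        fun i => (t.state (s i) k).getD (Classical.arbitrary M) := by
      funext i
      simp [current, hω]
    rw [h0, e] at this
    rw [Formula.Realize, Formula.Realize]
    convert this.symm using 2
  simp only [eventualSet, Set.mem_ofPred_eq, key, Filter.eventually_const]

lemma pi_dirac_eventualSet (q : Measure (Option M)) [IsProbabilityMeasure q]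
    {φ : L.Formula (Fin n)} (hφ : (⟨0, φ⟩ : AllF L n) ∈ t.Δ 0)
    {b : Fin n → M} (hb : Function.Injective b) (hbB : ∀ i, b i ∈ t.B 0) [Decidable (φ.Realize b)] :
    Measure.pi (fun i => seedLaw (Measure.dirac (some (b i))) q) (t.eventualSet φ) =
      if φ.Realize b then 1 else 0 := by
  have hae : ∀ᵐ s ∂Measure.pi (fun i => seedLaw (Measure.dirac (some (b i))) q),
      ∀ i, (s i).1 = some (b i) := by
    refine ae_all_iff.2 fun i => ?_
    have h1 : ∀ᵐ u ∂seedLaw (Measure.dirac (some (b i))) q, u.1 = some (b i) := by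
      refine Measure.quasiMeasurePreserving_fst.ae (p := fun u => u = some (b i)) ?_
      rw [ae_dirac_iff MeasurableSet.of_discrete]
    exact (Measure.quasiMeasurePreserving_eval
      (fun i => seedLaw (Measure.dirac (some (b i))) q) i).ae h1
  split_ifs with h
  · rw [← measure_univ (μ := Measure.pi fun i => seedLaw (Measure.dirac (some (b i))) q)]
    refine measure_congr (Filter.eventuallyEq_univ.2 ?_)
    filter_upwards [hae] with s hs using (mem_eventualSet_iff hφ hb hbB hs).2 h
  · refine measure_mono_null (fun s hs => ?_) hae
    exact fun hs' => h ((mem_eventualSet_iff hφ hb hbB hs').1 hs)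

variable [Countable M]

lemma measurableSet_eventualSet (φ : L.Formula (Fin n)) : MeasurableSet (t.eventualSet φ) :=
  measurableSet_eventually fun v => φ.Realize v

lemma law_satF [L.IsRelational] {w q : Measure (Option M)} [IsProbabilityMeasure w]
    [IsProbabilityMeasure q] (hgen : ∀ᵐ ω ∂iid (seedLaw w q), t.Generic ω)
    (φ : L.Formula (Fin n)) :
    t.law w q {x | SatF L x φ fun i => (i : ℕ)} =
      Measure.pi (fun _ : Fin n => seedLaw w q) (t.eventualSet φ) := by
  rw [law, Measure.map_apply t.measurable_limit (measurableSet_satF φ _),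
    ← Measure.infinitePi_eq_pi, ← iid_map_comp (seedLaw w q) Fin.val_injective,
    Measure.map_apply (measurable_comp_index _) (measurableSet_eventualSet φ)]
  refine measure_congr ?_
  filter_upwards [hgen] with ω hω
  exact propext (hω.satF_iff φ _)

lemma law_weighted_satF [L.IsRelational] {S : Type} [Fintype S] (ι : S → Option M) {x : S → ℝ}
    (hx : x ∈ posSimplex S) {q : Measure (Option M)} [IsProbabilityMeasure q]
    [IsProbabilityMeasure (weighted ι x)]
    (hgen : ∀ᵐ ω ∂iid (seedLaw (weighted ι x) q), t.Generic ω) (φ : L.Formula (Fin n)) :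
    (t.law (weighted ι x) q {y | SatF L y φ fun i => (i : ℕ)}).toReal =
      ∑ f : Fin n → S, (∏ i, x (f i)) *
        (Measure.pi (fun i => seedLaw (Measure.dirac (ι (f i))) q) (t.eventualSet φ)).toReal := by
  have hprod : seedLaw (weighted ι x) q =
      ∑ s, ENNReal.ofReal (x s) • seedLaw (Measure.dirac (ι s)) q := by
    have : SigmaFinite (∑ s, ENNReal.ofReal (x s) • Measure.dirac (ι s)) :=
      inferInstanceAs (SigmaFinite (weighted ι x))
    exact sum_smul_prod _ _ _
  have : SigmaFinite (∑ s, ENNReal.ofReal (x s) • seedLaw (Measure.dirac (ι s)) q) :=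
    hprod ▸ inferInstance
  rw [law_satF hgen]
  simp_rw [hprod]
  rw [pi_sum_smul]
  simp only [Measure.finsetSum_apply, Measure.smul_apply, smul_eq_mul]
  rw [ENNReal.toReal_sum fun f _ =>
    ENNReal.mul_ne_top (ENNReal.prod_ne_top fun _ _ => ENNReal.ofReal_ne_top) (measure_ne_top _ _)]
  refine Finset.sum_congr rfl fun f _ => ?_
  rw [ENNReal.toReal_mul, ENNReal.toReal_prod]
  congr 1
  exact Finset.prod_congr rfl fun i _ => ENNReal.toReal_ofReal (hx.1 _).le

end Tower

section Count

variable {L} {M : Type} [L.Structure M] {n : ℕ}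

open Classical in
/-- A `χ`-tuple has a disjoint twin which some formula separates from all rearrangements of the
original tuple. -/
lemma exists_separated_twin (hdcl : TrivDcl L M) {χ : L.Formula (Fin n)}
    (hroot : ∀ v w : Fin n → M, χ.Realize v →
      (∀ φ : L.Formula (Fin n), φ.Realize v ↔ φ.Realize w) → ∃ i j, v i = w j)
    {a : Fin n → M} (ha : χ.Realize a) (hinj : Function.Injective a) :
    ∃ (a' : Fin n → M) (φ : L.Formula (Fin n)), Function.Injective a' ∧ φ.Realize a' ∧
      ∀ f : Fin n → Fin n, ¬ φ.Realize (a ∘ f) := by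
  obtain ⟨d, hd, hdinj, hpres⟩ := exists_dup hdcl {(⟨0, χ⟩ : AllF L n)} (Finset.univ.image a)
  have hmem : ∀ i, a i ∈ Finset.univ.image a := fun i =>
    Finset.mem_image_of_mem _ (Finset.mem_univ i)
  have hχ : χ.Realize (d ∘ a) := by
    have := hpres _ (Finset.mem_singleton_self _) d (fun b _ => Or.inr rfl) a Fin.elim0 hmem
      (fun i => i.elim0)
    rw [Formula.Realize] at ha ⊢
    convert this.1 (by convert ha using 1) using 1
  have hsep : ∀ f : Fin n → Fin n, ∃ φ : L.Formula (Fin n), φ.Realize (d ∘ a) ∧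
      ¬ φ.Realize (a ∘ f) := by
    intro f
    by_contra! hcon
    obtain ⟨i, j, hij⟩ := hroot (d ∘ a) (a ∘ f) hχ fun φ => by
      refine ⟨hcon φ, fun h => ?_⟩
      by_contra h'
      exact Formula.realize_not.1 (hcon φ.not (Formula.realize_not.2 h')) h
    exact hd (a i) (hmem i) ((show d (a i) = a (f j) from hij) ▸ hmem (f j))
  choose φ h1 h2 using hsep
  refine ⟨d ∘ a, Formula.iInf φ, fun i j hij => hinj (hdinj (by simp) (by simp) hij), ?_, ?_⟩
  · exact Formula.realize_iInf.2 h1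
  · exact fun f h => h2 f (Formula.realize_iInf.1 h f)

variable [L.IsRelational] [∀ n, Countable (L.Relations n)] [Countable M] [Nonempty M]

open Classical in
theorem continuum_le_mk_ergodicStructures (hdcl : TrivDcl L M) {T : Set L.Sentence}
    (hT : ∀ φ ∈ T, M ⊨ φ) {χ : L.Formula (Fin n)}
    (hroot : ∀ v w : Fin n → M, χ.Realize v →
      (∀ φ : L.Formula (Fin n), φ.Realize v ↔ φ.Realize w) → ∃ i j, v i = w j)
    {a : Fin n → M} (ha : χ.Realize a) (hinj : Function.Injective a)
    (hex : ∀ x : StrL L, (∀ φ ∈ T, SatS L x φ) → ∃ v, SatF L x χ v) :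
    Cardinal.continuum ≤ Cardinal.mk {μ : Measure (StrL L) //
      IsErgodicStructure L μ ∧ OrbitsNull L μ ∧ ∀ φ ∈ T, μ (extS L φ) = 1} := by
  have hcF : Countable (L.Formula (Fin n)) :=
    Function.Injective.countable (f := fun φ => (⟨0, φ⟩ : AllF L n)) fun φ ψ h => by simpa using h
  obtain ⟨a', φ₀, ha', hφa', hφa⟩ := exists_separated_twin hdcl hroot ha hinj
  obtain ⟨t, htB, htΔ⟩ := exists_tower (L := L) (n := n) hdcl
    (Finset.univ.image a ∪ Finset.univ.image a') ⟨0, φ₀⟩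
  have hB : ∀ i, a i ∈ t.B 0 := fun i => by simp [htB]
  have hB' : ∀ i, a' i ∈ t.B 0 := fun i => by simp [htB]
  obtain ⟨q, hq, hq0⟩ := exists_fullSupport M
  let S := Option {b // b ∈ t.B 0}
  let ι : S → Option M := Option.map Subtype.val
  let ν : (Fin n → S) → ℝ := fun f =>
    (Measure.pi (fun i => seedLaw (Measure.dirac (ι (f i))) q) (t.eventualSet φ₀)).toReal
  let α : Fin n → S := fun i => some ⟨a i, hB i⟩
  let α' : Fin n → S := fun i => some ⟨a' i, hB' i⟩
  have hα : Function.Injective α := fun i j h => 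
    hinj (congrArg Subtype.val (Option.some_injective _ h))
  have hν0 : ∀ f, Function.Injective f → (∀ i, f i ∈ Set.range α) → ν f = 0 := by
    intro f hf hfr
    choose g hg using hfr
    obtain rfl : α ∘ g = f := funext hg
    have h := Tower.pi_dirac_eventualSet q htΔ (hinj.comp hf.of_comp) fun i => hB (g i)
    rw [if_neg (hφa g)] at h
    simp only [ν]
    rw [ENNReal.toReal_eq_zero_iff]
    exact Or.inl h
  have hν1 : 0 < ν α' := by
    have h := Tower.pi_dirac_eventualSet q htΔ ha' hB'
    rw [if_pos hφa'] at h
    have : ν α' = (1 : ℝ≥0∞).toReal := congrArg ENNReal.toReal h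
    rw [this]
    simp
  obtain ⟨x, hx, y, hy, hxy⟩ :=
    exists_ne_on_posSimplex (fun f => ENNReal.toReal_nonneg) hα hν0 hν1
  refine (continuum_le_image_posSimplex hx hy hxy).trans ?_
  let F : {μ : Measure (StrL L) //
      IsErgodicStructure L μ ∧ OrbitsNull L μ ∧ ∀ φ ∈ T, μ (extS L φ) = 1} → ℝ :=
    fun μ => (μ.1 {y | SatF L y φ₀ fun i => (i : ℕ)}).toReal
  refine (Cardinal.mk_le_mk_of_subset ?_).trans (Cardinal.mk_range_le (f := F))
  rintro _ ⟨z, hz, rfl⟩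
  have := isProbabilityMeasure_weighted ι hz
  have hgen := t.ae_generic (weighted ι z) q (weighted_singleton_ne_zero ι hz none)
    (weighted_eq_zero ι z fun s => by cases s <;> simp [ι]) hq0
  exact ⟨⟨t.law (weighted ι z) q, t.law_isErgodicStructure _ _,
    t.law_orbitsNull hgen hroot fun ω hω => hex _ fun φ hφ => hω.satS (hT φ hφ),
    fun φ hφ => t.law_extS hgen (hT φ hφ)⟩, Tower.law_weighted_satF ι hz hgen φ₀⟩

end Count

section Reduction

variable {L} {n : ℕ}

/-- The sentence expressing that some tuple defines, through `φ`, a unique further element. -/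
noncomputable def dclSentence {p : ℕ} (φ : L.Formula (Fin (p + 1))) : L.Sentence :=
  Formula.iExs (Fin p) (Formula.relabel Sum.inr (Formula.iExsUnique Unit
    ((Formula.iInf fun i : Fin p => (Term.equal (Term.var (Sum.inr ())) (Term.var (Sum.inl i))).not) ⊓
      φ.relabel (Fin.lastCases (Sum.inr ()) Sum.inl : Fin (p + 1) → Fin p ⊕ Unit))))

lemma realize_dclSentence {N : Type} [L.Structure N] {p : ℕ} (φ : L.Formula (Fin (p + 1))) :
    N ⊨ dclSentence φ ↔ ∃ a : Fin p → N, ∃! b : N, (∀ i, b ≠ a i) ∧ φ.Realize (Fin.snoc a b) := by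
  have hcomp : ∀ (a : Fin p → N) (b : Unit → N), Sum.elim a b ∘
      (Fin.lastCases (Sum.inr ()) Sum.inl : Fin (p + 1) → Fin p ⊕ Unit) =
        (Fin.snoc a (b ()) : Fin (p + 1) → N) := by
    intro a b
    funext i
    refine Fin.lastCases ?_ (fun i => ?_) i <;> simp
  rw [Sentence.Realize, dclSentence, Formula.realize_iExs]
  refine exists_congr fun a => ?_
  rw [Formula.realize_relabel, Formula.realize_iExsUnique]
  simp only [Formula.realize_inf, Formula.realize_iInf, Formula.realize_not, Formula.realize_equal,
    Term.realize_var, Formula.realize_relabel, Sum.elim_comp_inr, hcomp, Sum.elim_inl, Sum.elim_inr]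
  exact (Equiv.funUnique Unit N).existsUnique_congr fun {b} => Iff.rfl

lemma satSIn_iff_mem {T : Set L.Sentence}
    (hcomplete : ∃ (M : Type) (iM : L.Structure M), T = {φ | SatSIn L M iM φ})
    {N : Type} [iN : L.Structure N] (hN : ∀ ψ ∈ T, SatSIn L N iN ψ) (φ : L.Sentence) :
    SatSIn L N iN φ ↔ φ ∈ T := by
  refine ⟨fun h => ?_, hN φ⟩
  obtain ⟨M, iM, rfl⟩ := hcomplete
  by_contra hφ
  exact (hN φ.not hφ) h

lemma trivDcl_of_complete {T : Set L.Sentence}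
    (hcomplete : ∃ (M : Type) (iM : L.Structure M), T = {φ | SatSIn L M iM φ})
    (hdcl : ¬ ∃ (n : ℕ) (φ : L.Formula (Fin (n + 1))),
      ∀ (N : Type) (iN : L.Structure N), (∀ ψ ∈ T, SatSIn L N iN ψ) →
        ∃ a : Fin n → N, ∃! b : N, (∀ i, b ≠ a i) ∧ RealizeIn L N iN φ (Fin.snoc a b))
    {N : Type} [iN : L.Structure N] (hN : ∀ ψ ∈ T, SatSIn L N iN ψ) : TrivDcl L N := by
  intro p φ a b hb hφ
  by_contra! hcon
  have hmem : dclSentence φ ∈ T := by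
    refine (satSIn_iff_mem hcomplete hN _).1 ((realize_dclSentence φ).2 ⟨a, b, ⟨hb, hφ⟩, ?_⟩)
    intro b' hb'
    by_contra hne
    exact hcon b' hne hb'.1 hb'.2
  exact hdcl ⟨p, φ, fun N' iN' hN' => (realize_dclSentence φ).1 (hN' _ hmem)⟩

lemma ChiRootedFullOn.exists_eq {M : Type} [iM : L.Structure M] {χ : L.Formula (Fin n)}
    (h : ChiRootedFullOn L M iM χ) (hinj : ∀ a : Fin n → M, χ.Realize a → Function.Injective a)
    {v w : Fin n → M} (hv : χ.Realize v)
    (hvw : ∀ φ : L.Formula (Fin n), φ.Realize v ↔ φ.Realize w) : ∃ i j, v i = w j := by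
  obtain ⟨r, hr⟩ := h {φ | RealizeIn L M iM φ v} ⟨M, iM, v, rfl⟩
    (fun i j hij => Formula.realize_not.2 fun he => hij (hinj v hv (Formula.realize_equal.1 he)))
    hv ⟨v, fun φ hφ => hφ⟩
  obtain ⟨i, hi⟩ := hr v fun φ hφ => hφ
  obtain ⟨j, hj⟩ := hr w fun φ hφ => (hvw φ).1 hφ
  exact ⟨i, j, hi.trans hj.symm⟩

lemma exists_countable_elementaryEmbedding [L.IsRelational] [∀ n, Countable (L.Relations n)]
    (M : Type) [L.Structure M] :
    ∃ (N : Type) (_ : L.Structure N), Countable N ∧ Nonempty (N ↪ₑ[L] M) := by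
  by_cases hM : Countable M
  · exact ⟨M, inferInstance, hM, ⟨ElementaryEmbedding.refl L M⟩⟩
  · have hcard : L.card ≤ Cardinal.aleph0 := Cardinal.mk_le_aleph0_iff.2 inferInstance
    obtain ⟨S, -, hS⟩ := exists_elementarySubstructure_card_eq L (∅ : Set M) Cardinal.aleph0.{0}
      le_rfl (by simp) (by simpa using hcard)
      (by simpa using (not_le.1 fun h => hM (Cardinal.mk_le_aleph0_iff.1 h)).le)
    exact ⟨S, inferInstance, Cardinal.mk_le_aleph0_iff.1 (by simpa using hS.le), ⟨S.subtype⟩⟩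

end Reduction

/-- The main construction theorem, first-order instance: if T is a complete first-order theory
with trivial definable closure, χ(x̄) is a formula such that T proves χ-tuples are injective
and χ is realized, and T has a model which is χ-rooted with respect to complete first-order
types, then there are continuum-many properly ergodic structures almost surely satisfying T. -/
theorem statement15 [L.IsRelational] [∀ n, Countable (L.Relations n)]
    (T : Set L.Sentence)
    (hcomplete : ∃ (M : Type) (iM : L.Structure M), T = {φ | SatSIn L M iM φ})
    (hdcl : ¬ ∃ (n : ℕ) (φ : L.Formula (Fin (n + 1))),
      ∀ (N : Type) (iN : L.Structure N), (∀ ψ ∈ T, SatSIn L N iN ψ) →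
        ∃ a : Fin n → N, ∃! b : N, (∀ i, b ≠ a i) ∧ RealizeIn L N iN φ (Fin.snoc a b))
    (n : ℕ) (χ : L.Formula (Fin n))
    (hinj : ∀ (N : Type) (iN : L.Structure N), (∀ ψ ∈ T, SatSIn L N iN ψ) →
      ∀ a : Fin n → N, RealizeIn L N iN χ a → Function.Injective a)
    (hex : ∀ (N : Type) (iN : L.Structure N), (∀ ψ ∈ T, SatSIn L N iN ψ) →
      ∃ a : Fin n → N, RealizeIn L N iN χ a)
    (hM : ∃ (M : Type) (iM : L.Structure M),
      (∀ ψ ∈ T, SatSIn L M iM ψ) ∧ ChiRootedFullOn L M iM χ) :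
    Cardinal.mk {μ : Measure (StrL L) //
        IsErgodicStructure L μ ∧ OrbitsNull L μ ∧ ∀ φ ∈ T, μ (extS L φ) = 1} =
      Cardinal.continuum := by
  refine le_antisymm (mk_probabilityMeasure_le _ fun μ hμ => hμ.1.1) ?_
  obtain ⟨M, iM, hMT, hroot⟩ := hM
  obtain ⟨N, iN, hNc, ⟨e⟩⟩ := exists_countable_elementaryEmbedding (L := L) M
  have hNT : ∀ ψ ∈ T, SatSIn L N iN ψ := fun ψ hψ => (e.map_sentence ψ).2 (hMT ψ hψ)
  have hNroot : ∀ v w : Fin n → N, χ.Realize v →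
      (∀ φ : L.Formula (Fin n), φ.Realize v ↔ φ.Realize w) → ∃ i j, v i = w j := by
    intro v w hv hvw
    obtain ⟨i, j, hij⟩ := hroot.exists_eq (hinj M iM hMT) ((e.map_formula χ v).2 hv)
      fun φ => (e.map_formula φ v).trans ((hvw φ).trans (e.map_formula φ w).symm)
    exact ⟨i, j, e.injective hij⟩
  obtain ⟨a, ha⟩ := hex N iN hNT
  have : Nonempty N := ⟨a (hNroot a a ha fun _ => Iff.rfl).choose⟩
  exact continuum_le_mk_ergodicStructures (trivDcl_of_complete hcomplete hdcl hNT) hNT hNroot ha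
    (hinj N iN hNT a ha) fun x hx => hex ℕ (toStructure L x) hx

end Ergo
end

section
/- Let μ be an ergodic structure. Then the almost-sure first-order theory Th_FO(μ) = {φ a first-order sentence : μ(⟦φ⟧) = 1} has a Borel model of cardinality 2^ℵ₀: there is an L-structure N whose domain is a standard Borel space of cardinality 2^ℵ₀, with each relation R^N ⊆ N^{ar(R)} a Borel set, such that N ⊨ Th_FO(μ). -/
open FirstOrder Language MeasureTheory Set
open scoped ENNReal

namespace Ergo


variable (L : FirstOrder.Language.{0,0})

/-- A Borel L-structure: a standard Borel domain with Borel relations. -/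
structure BorelStruct (L : FirstOrder.Language.{0,0}) where
  (dom : Type)
  [ms : MeasurableSpace dom]
  [sbs : StandardBorelSpace dom]
  [str : L.Structure dom]
  (rel_meas : ∀ (k : ℕ) (r : L.Relations k),
    MeasurableSet {a : Fin k → dom | Structure.RelMap r a})

attribute [instance] BorelStruct.ms BorelStruct.sbs BorelStruct.str

/-- The sampling map sending an ℕ-indexed family of points of the Borel structure to the
induced structure on ℕ. -/
noncomputable def samplingMap (B : BorelStruct L) (a : ℕ → B.dom) : StrL L :=
  fun n r v => @decide (Structure.RelMap r (fun i => a (v i))) (Classical.propDecidable _)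

/-- `ξ` is the i.i.d. product measure `ν^⊗ℕ` on `ℕ → M`. -/
def IsIIDProduct {M : Type} [MeasurableSpace M] (ν : Measure M)
    (ξ : Measure (ℕ → M)) : Prop :=
  IsProbabilityMeasure ξ ∧
    ∀ (s : Finset ℕ) (t : ℕ → Set M), (∀ i ∈ s, MeasurableSet (t i)) →
      ξ {a | ∀ i ∈ s, a i ∈ t i} = ∏ i ∈ s, ν (t i)

/-- The distribution of a point of `ι → ℕ` obtained from `x` by resampling the coordinates in the
list one after the other, each according to `U`. -/
def resample (U : Ultrafilter ℕ) {ι : Type} [DecidableEq ι] :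
    List ι → (ι → ℕ) → Ultrafilter (ι → ℕ)
  | [], x => pure x
  | s :: l, x => U.bind fun m => resample U l (Function.update x s m)

section Resample

variable {U : Ultrafilter ℕ} {ι : Type} [DecidableEq ι]

lemma eventually_resample_nil {x : ι → ℕ} {A : (ι → ℕ) → Prop} :
    (∀ᶠ z in resample U [] x, A z) ↔ A x := Iff.rfl

lemma eventually_resample_cons {s : ι} {l : List ι} {x : ι → ℕ} {A : (ι → ℕ) → Prop} :
    (∀ᶠ z in resample U (s :: l) x, A z) ↔
      ∀ᶠ m in U, ∀ᶠ z in resample U l (Function.update x s m), A z := Iff.rfl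

lemma eventually_resample_append {l₁ l₂ : List ι} {x : ι → ℕ} {A : (ι → ℕ) → Prop} :
    (∀ᶠ z in resample U (l₁ ++ l₂) x, A z) ↔
      ∀ᶠ y in resample U l₁ x, ∀ᶠ z in resample U l₂ y, A z := by
  induction l₁ generalizing x with
  | nil => rfl
  | cons s l ih => simp only [List.cons_append, eventually_resample_cons, ih]

lemma eventually_resample_congr {l : List ι} {T : Set ι} {A : (ι → ℕ) → Prop}
    (hA : DependsOn A T) {x y : ι → ℕ} (h : ∀ i ∈ T, i ∉ l → x i = y i) :
    (∀ᶠ z in resample U l x, A z) ↔ ∀ᶠ z in resample U l y, A z := by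
  induction l generalizing x y with
  | nil => exact iff_of_eq (hA fun i hi => h i hi (by simp))
  | cons s l ih =>
    simp only [eventually_resample_cons]
    refine Filter.eventually_congr (.of_forall fun m => ih fun i hi hil => ?_)
    by_cases his : i = s
    · simp [his]
    · simpa [his] using h i hi (by simp [his, hil])

lemma eventually_resample_eq_off (l : List ι) (x : ι → ℕ) :
    ∀ᶠ z : ι → ℕ in resample U l x, ∀ i ∉ l, z i = x i := by
  induction l generalizing x with
  | nil => exact eventually_resample_nil.2 fun _ _ => rfl
  | cons s l ih =>
    refine eventually_resample_cons.2 (.of_forall fun m => (ih _).mono fun z hz i hi => ?_)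
    simp only [List.mem_cons, not_or] at hi
    simpa [hi.1] using hz i hi.2

lemma eventually_resample_update {l : List ι} {s : ι} (hs : s ∉ l) {x : ι → ℕ} {m : ℕ}
    {A : (ι → ℕ) → Prop} :
    (∀ᶠ z in resample U l x, A (Function.update z s m)) ↔
      ∀ᶠ z in resample U l (Function.update x s m), A z := by
  induction l generalizing x with
  | nil => rfl
  | cons t l ih =>
    simp only [List.mem_cons, not_or] at hs
    simp only [eventually_resample_cons, ih hs.2, Function.update_comm hs.1]

lemma eventually_resample_comp {κ : Type} [DecidableEq κ] {e : κ → ι} (he : e.Injective)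
    {l : List ι} {l' : List κ} (h : ∀ [DecidablePred (· ∈ range e)],
      l'.map e = l.filter (· ∈ range e)) {x : ι → ℕ}
    {A : (κ → ℕ) → Prop} :
    (∀ᶠ z in resample U l x, A (z ∘ e)) ↔ ∀ᶠ y in resample U l' (x ∘ e), A y := by
  classical
  replace h : l'.map e = l.filter (· ∈ range e) := h
  induction l generalizing x l' with
  | nil =>
    simp only [List.filter_nil, List.map_eq_nil_iff] at h
    subst h; rfl
  | cons s l ih =>
    by_cases hs : s ∈ range e
    · rw [List.filter_cons_of_pos (by simpa using hs), List.map_eq_cons_iff] at h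
      obtain ⟨k, l'', rfl, rfl, hl⟩ := h
      simp only [eventually_resample_cons, ih hl, Function.update_comp_eq_of_injective _ he]
    · rw [List.filter_cons_of_neg (by simpa using hs)] at h
      simp only [eventually_resample_cons, ih h]
      have : ∀ m, Function.update x s m ∘ e = x ∘ e := fun m =>
        Function.update_comp_eq_of_notMem_range _ _ hs
      simp [this]

/-- If a function of the coordinates in `S` agrees almost surely with a function that ignores the
coordinate `s`, it agrees almost surely with a function of the coordinates in `S \ {s}`. -/
lemma exists_dependsOn_diff_resample {l : List ι} (hl : l.Nodup) {S T : Set ι} {s : ι}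
    (hsl : s ∈ l) (hsT : s ∉ T) {F G : (ι → ℕ) → ℕ} (hF : DependsOn F S) (hG : DependsOn G T)
    {x₀ : ι → ℕ} (h : ∀ᶠ z in resample U l x₀, F z = G z) :
    ∃ F' : (ι → ℕ) → ℕ, DependsOn F' (S \ {s}) ∧ ∀ᶠ z in resample U l x₀, F' z = F z := by
  obtain ⟨l₁, l₂, rfl⟩ := List.append_of_mem hsl
  have hs₂ : s ∉ l₂ := by
    have := (List.nodup_append.1 hl).2.1
    simp_all
  let Q : (ι → ℕ) → ℕ → Prop := fun x m =>
    ∀ᶠ z in resample U (s :: l₂) x, F (Function.update z s m) = F z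
  have hdep : ∀ m, DependsOn (fun z => F (Function.update z s m) = F z) S := by
    intro m x y hxy
    have h1 : F x = F y := hF hxy
    have h2 : F (Function.update x s m) = F (Function.update y s m) := hF fun i hi => by
      by_cases his : i = s
      · simp [his]
      · simpa [his] using hxy i hi
    simp only [h1, h2]
  have hQ : ∀ {x y : ι → ℕ}, (∀ i ∈ S, i ∉ s :: l₂ → x i = y i) → Q x = Q y := fun {x y} hxy =>
    funext fun m => propext (eventually_resample_congr (hdep m) hxy)
  refine ⟨fun x => F (Function.update x s (sInf {m | Q x m})), ?_, ?_⟩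
  · intro x y hxy
    have hQxy : Q x = Q y := hQ fun i hi hil => hxy i ⟨hi, by
      rintro rfl
      simp at hil⟩
    simp only [hQxy]
    refine hF fun i hi => ?_
    by_cases his : i = s
    · simp [his]
    · simpa [his] using hxy i ⟨hi, his⟩
  · rw [eventually_resample_append] at h ⊢
    refine h.mono fun x hx => ?_
    have hne : ∃ m, Q x m := by
      rw [eventually_resample_cons] at hx
      obtain ⟨m, hm⟩ := hx.exists
      refine ⟨m, eventually_resample_cons.2 (hx.mono fun m' hm' => ?_)⟩
      have hm2 : ∀ᶠ z in resample U l₂ (Function.update (Function.update x s m') s m),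
          F z = G z := by
        simpa using hm
      rw [← eventually_resample_update hs₂] at hm2
      filter_upwards [hm', hm2] with z hz hz2
      rw [hz2, hz]
      refine hG fun i hi => ?_
      rw [Function.update_of_ne]
      rintro rfl
      exact hsT hi
    have hmem : Q x (sInf {m | Q x m}) := Nat.sInf_mem (s := {m | Q x m}) hne
    filter_upwards [hmem, eventually_resample_eq_off (s :: l₂) x] with z hz hoff
    have : Q z = Q x := hQ fun i _ hi => hoff i hi
    rw [this, hz]

end Resample

/-- The limit, over the finite subsets of `ι`, of the iterated ultrafilter powers of a fixed
nonprincipal ultrafilter on `ℕ`. -/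
noncomputable def iteratedPower (ι : Type) [LinearOrder ι] : Ultrafilter (ι → ℕ) :=
  (Ultrafilter.of (Filter.atTop : Filter (Finset ι))).bind
    fun S => resample (Filter.hyperfilter ℕ) S.sort 0

section IteratedPower

variable {ι : Type} [LinearOrder ι]

lemma eventually_iteratedPower {A : (ι → ℕ) → Prop} :
    (∀ᶠ x in iteratedPower ι, A x) ↔
      ∀ᶠ S : Finset ι in Ultrafilter.of (Filter.atTop : Filter (Finset ι)),
        ∀ᶠ x in resample (Filter.hyperfilter ℕ) S.sort 0, A x := Iff.rfl

lemma eventually_resample_sort_comp {κ : Type} [LinearOrder κ] [Fintype κ] {e : κ → ι}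
    (he : StrictMono e) {S : Finset ι} (hS : ∀ i, e i ∈ S) {A : (κ → ℕ) → Prop} :
    (∀ᶠ z in resample (Filter.hyperfilter ℕ) S.sort 0, A (z ∘ e)) ↔
      ∀ᶠ y in resample (Filter.hyperfilter ℕ) (Finset.univ : Finset κ).sort 0, A y := by
  refine eventually_resample_comp he.injective ?_
  intro _
  refine List.SortedLT.eq_of_mem_iff ?_ ?_ ?_
  · exact he.sortedLT_listMap.2 (Finset.sortedLT_sort _)
  · exact ((Finset.sortedLT_sort S).pairwise.filter _).sortedLT
  · intro a
    simp only [List.mem_map, Finset.mem_sort, Finset.mem_univ, true_and, List.mem_filter,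
      mem_range, decide_eq_true_eq]
    constructor
    · rintro ⟨i, rfl⟩
      exact ⟨hS i, i, rfl⟩
    · exact fun h => h.2

lemma eventually_iteratedPower_comp {κ : Type} [LinearOrder κ] [Fintype κ] {e : κ → ι}
    (he : StrictMono e) {A : (κ → ℕ) → Prop} :
    (∀ᶠ x in iteratedPower ι, A (x ∘ e)) ↔
      ∀ᶠ y in resample (Filter.hyperfilter ℕ) (Finset.univ : Finset κ).sort 0, A y := by
  rw [eventually_iteratedPower]
  have hlarge : ∀ᶠ S : Finset ι in Ultrafilter.of (Filter.atTop : Filter (Finset ι)), ∀ i, e i ∈ S :=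
    (Ultrafilter.of_le _) <| by
      filter_upwards [Filter.eventually_ge_atTop (Finset.univ.image e)] with S hS i
      exact hS (by simp)
  constructor
  · intro h
    obtain ⟨S, h1, h2⟩ := (h.and hlarge).exists
    exact (eventually_resample_sort_comp he h2).1 h1
  · intro h
    filter_upwards [hlarge] with S hS
    exact (eventually_resample_sort_comp he hS).2 h

/-- Tuples of the same order type are indiscernible. -/
lemma eventually_iteratedPower_pattern {κ : Type} [Finite κ] {c d : κ → ι}
    (h : ∀ i j, c i ≤ c j ↔ d i ≤ d j) (A : (κ → ℕ) → Prop) :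
    (∀ᶠ x in iteratedPower ι, A (x ∘ c)) ↔ ∀ᶠ x in iteratedPower ι, A (x ∘ d) := by
  classical
  have : Fintype (range c) := Fintype.ofFinite _
  choose r hr using fun t : range c => t.2
  have hlt : ∀ i j, c i < c j ↔ d i < d j := fun i j => by
    rw [← not_le, ← not_le, h]
  have h1 : StrictMono (Subtype.val : range c → ι) := fun _ _ hab => hab
  have h2 : StrictMono (fun t => d (r t) : range c → ι) := fun a b hab => by
    rw [← hlt, hr, hr]
    exact hab
  have hd : ∀ i, d (r ⟨c i, i, rfl⟩) = d i := fun i => by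
    have := hr ⟨c i, i, rfl⟩
    exact le_antisymm ((h _ _).1 this.le) ((h _ _).1 this.ge)
  let A' : (range c → ℕ) → Prop := fun y => A fun i => y ⟨c i, i, rfl⟩
  have e1 := eventually_iteratedPower_comp h1 (A := A')
  have e2 := eventually_iteratedPower_comp h2 (A := A')
  have := e1.trans e2.symm
  simpa only [A', Function.comp_def, hd] using this

lemma exists_dependsOn_diff {S T : Set ι} (hS : S.Finite) {s : ι} (hsT : s ∉ T)
    {F G : (ι → ℕ) → ℕ} (hF : DependsOn F S) (hG : DependsOn G T)
    (h : ∀ᶠ x : ι → ℕ in iteratedPower ι, F x = G x) :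
    ∃ F' : (ι → ℕ) → ℕ, DependsOn F' (S \ {s}) ∧ ∀ᶠ x in iteratedPower ι, F' x = F x := by
  classical
  have hlarge : ∀ᶠ R in Ultrafilter.of (Filter.atTop : Filter (Finset ι)),
      insert s hS.toFinset ⊆ R :=
    (Ultrafilter.of_le _) <| Filter.eventually_ge_atTop (insert s hS.toFinset)
  obtain ⟨R, hR, hsub⟩ := ((eventually_iteratedPower.1 h).and hlarge).exists
  obtain ⟨F', hF', hFF'⟩ := exists_dependsOn_diff_resample (Finset.sort_nodup R _)
    ((Finset.mem_sort _).2 (hsub (Finset.mem_insert_self _ _))) hsT hF hG hR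
  refine ⟨F', hF', ?_⟩
  let A : (hS.toFinset → ℕ) → Prop := fun y =>
    F' (fun t => if ht : t ∈ hS.toFinset then y ⟨t, ht⟩ else 0) =
      F (fun t => if ht : t ∈ hS.toFinset then y ⟨t, ht⟩ else 0)
  have hA : ∀ x : ι → ℕ, A (x ∘ Subtype.val) ↔ F' x = F x := by
    intro x
    have e1 : F' (fun t => if ht : t ∈ hS.toFinset then x t else 0) = F' x :=
      hF' fun i hi => by simp [hi.1]
    have e2 : F (fun t => if ht : t ∈ hS.toFinset then x t else 0) = F x :=
      hF fun i hi => by simp [hi]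
    simp only [A, Function.comp_apply, e1, e2]
  have hmono : StrictMono (Subtype.val : hS.toFinset → ι) := fun _ _ hab => hab
  have e1 := eventually_iteratedPower_comp hmono (A := A)
  have e2 := eventually_resample_sort_comp hmono (S := R)
    (fun i => hsub (Finset.mem_insert_of_mem i.2)) (A := A)
  simp only [hA] at e1 e2
  exact e1.2 (e2.1 hFF')

lemma not_eventually_iteratedPower_eq_const (s : ι) (c : ℕ) :
    ¬ ∀ᶠ x : ι → ℕ in iteratedPower ι, x s = c := by
  intro h
  have hmono : StrictMono (fun _ : Unit => s) := fun a b hab => absurd hab (by simp)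
  have := (eventually_iteratedPower_comp hmono (A := fun y => y () = c)).1 h
  simp only [Finset.univ_unique, Finset.sort_singleton, eventually_resample_cons,
    eventually_resample_nil, PUnit.default_eq_unit, Function.update_self] at this
  exact (Filter.notMem_hyperfilter_of_finite (finite_singleton c)) this

end IteratedPower

lemma exists_countable_closed {X J : Type} [Countable J] (ar : J → ℕ)
    (op : ∀ j, (Fin (ar j) → X) → X) (x₀ : X) :
    ∃ F : Set X, F.Countable ∧ x₀ ∈ F ∧ ∀ j p, (∀ i, p i ∈ F) → op j p ∈ F := by
  let G : ℕ → Set X := fun k => Nat.rec {x₀} (fun _ s => s ∪ ⋃ j, op j '' pi univ fun _ => s) k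
  have hsucc : ∀ k, G (k + 1) = G k ∪ ⋃ j, op j '' pi univ fun _ => G k := fun _ => rfl
  have hmono : Monotone G := monotone_nat_of_le_succ fun k => by
    rw [hsucc]
    exact subset_union_left
  refine ⟨⋃ k, G k, countable_iUnion fun k => ?_, mem_iUnion.2 ⟨0, rfl⟩, fun j p hp => ?_⟩
  · induction k with
    | zero => exact countable_singleton x₀
    | succ k ih =>
      rw [hsucc]
      exact ih.union (countable_iUnion fun j => (countable_univ_pi fun _ => ih).image _)
  · simp only [mem_iUnion] at hp
    choose k hk using hp
    refine mem_iUnion.2 ⟨Finset.univ.sup k + 1, ?_⟩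
    rw [hsucc]
    refine .inr (mem_iUnion.2 ⟨j, p, fun i _ => ?_, rfl⟩)
    exact hmono (Finset.le_sup (Finset.mem_univ i)) (hk i)

lemma _root_.DependsOn.comp_right {ι κ β : Type} {f : (κ → ℕ) → β} {S : Set κ} {T : Set ι}
    (hf : DependsOn f S) {a : κ → ι} (ha : MapsTo a S T) :
    DependsOn (fun x : ι → ℕ => f (x ∘ a)) T :=
  fun _ _ h => hf fun i hi => h (a i) (ha hi)

lemma _root_.DependsOn.comp₂ {ι α β γ : Type} {f : (ι → ℕ) → α} {g : (ι → ℕ) → β} {S : Set ι}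
    (hf : DependsOn f S) (hg : DependsOn g S) (r : α → β → γ) :
    DependsOn (fun x => r (f x) (g x)) S :=
  fun _ _ h => by simp only [hf h, hg h]

lemma eventually_comp_congr {n : ℕ} {a b : ℕ → ℝ} (ha : StrictMonoOn a (Iio n))
    (hb : StrictMonoOn b (Iio n)) {A : (ℕ → ℕ) → Prop} (hA : DependsOn A (Iio n)) :
    (∀ᶠ x in iteratedPower ℝ, A (x ∘ a)) ↔ ∀ᶠ x in iteratedPower ℝ, A (x ∘ b) := by
  have h := eventually_iteratedPower_pattern (c := fun i : Fin n => a i) (d := fun i => b i)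
    (fun i j => (ha.le_iff_le i.2 j.2).trans (hb.le_iff_le i.2 j.2).symm)
    (fun y => A fun j => if h : j < n then y ⟨j, h⟩ else 0)
  have key : ∀ (c : ℕ → ℝ) (x : ℝ → ℕ),
      A (fun j => if h : j < n then (x ∘ fun i : Fin n => c i) ⟨j, h⟩ else 0) = A (x ∘ c) :=
    fun c x => hA fun i hi => by simp [mem_Iio.1 hi]
  simpa only [key] using h

lemma strictMonoOn_natCast (s : Set ℕ) : StrictMonoOn (Nat.cast : ℕ → ℝ) s :=
  Nat.strictMono_cast.strictMonoOn s

/-- `f` is a function of the first `n` coordinates which is not almost surely equal to a function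
of a proper subset of these coordinates. -/
def Reduced (n : ℕ) (f : (ℕ → ℕ) → ℕ) : Prop :=
  DependsOn f (Iio n) ∧ ∀ i < n, ∀ f' : (ℕ → ℕ) → ℕ, DependsOn f' (Iio n \ {i}) →
    ¬ ∀ᶠ x : ℝ → ℕ in iteratedPower ℝ, f' (x ∘ Nat.cast) = f (x ∘ Nat.cast)

lemma reduced_eval_zero : Reduced 1 fun y => y 0 := by
  refine ⟨fun x y h => h 0 (by simp), fun i hi f' hf' h => ?_⟩
  obtain rfl : i = 0 := by omega
  refine not_eventually_iteratedPower_eq_const (ι := ℝ) (0 : ℕ) (f' 0) ?_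
  filter_upwards [h] with x hx
  rw [show f' 0 = f' (x ∘ Nat.cast) from hf' fun i hi => by simp at hi, hx]
  rfl

lemma Reduced.image_subset {n m : ℕ} {f g : (ℕ → ℕ) → ℕ} (hf : Reduced n f) (hg : Reduced m g)
    {a b : ℕ → ℝ} (ha : StrictMonoOn a (Iio n))
    (h : ∀ᶠ x : ℝ → ℕ in iteratedPower ℝ, f (x ∘ a) = g (x ∘ b)) :
    a '' Iio n ⊆ b '' Iio m := by
  rintro _ ⟨i, hi, rfl⟩
  by_contra hib
  obtain ⟨F', hF', hFF'⟩ := exists_dependsOn_diff ((finite_Iio n).image a) hib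
    (hf.1.comp_right (mapsTo_image a _)) (hg.1.comp_right (mapsTo_image b _)) h
  have hinv : ∀ j < n, Function.invFunOn a (Iio n) (a j) = j := fun j hj =>
    ha.injOn.leftInvOn_invFunOn hj
  let f' : (ℕ → ℕ) → ℕ := fun y => F' (y ∘ Function.invFunOn a (Iio n))
  have hf' : DependsOn f' (Iio n \ {i}) := by
    refine hF'.comp_right ?_
    rintro _ ⟨⟨j, hj, rfl⟩, hji⟩
    rw [hinv j hj]
    refine ⟨hj, ?_⟩
    rintro rfl
    exact hji rfl
  refine hf.2 i hi f' hf' ?_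
  refine (eventually_comp_congr ha (strictMonoOn_natCast _)
    (A := fun y => f' y = f y) ((hf'.mono sdiff_subset).comp₂ hf.1 _)).1 ?_
  filter_upwards [hFF'] with x hx
  rw [← hx]
  refine hF' ?_
  rintro _ ⟨⟨j, hj, rfl⟩, -⟩
  simp [hinv j hj]

lemma Reduced.eq_of_eventually_eq {n m : ℕ} {f g : (ℕ → ℕ) → ℕ} (hf : Reduced n f)
    (hg : Reduced m g) {a b : ℕ → ℝ} (ha : StrictMonoOn a (Iio n)) (hb : StrictMonoOn b (Iio m))
    (h : ∀ᶠ x : ℝ → ℕ in iteratedPower ℝ, f (x ∘ a) = g (x ∘ b)) :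
    n = m ∧ (∀ i < n, a i = b i) ∧
      ∀ᶠ x : ℝ → ℕ in iteratedPower ℝ, f (x ∘ Nat.cast) = g (x ∘ Nat.cast) := by
  have himg : a '' Iio n = b '' Iio m :=
    (hf.image_subset hg ha h).antisymm (hg.image_subset hf hb (h.mono fun _ hx => hx.symm))
  obtain rfl : n = m := by
    have := congrArg Set.ncard himg
    rwa [ha.injOn.ncard_image, hb.injOn.ncard_image, ncard_Iio_nat,
      ncard_Iio_nat] at this
  have hab : ∀ i < n, a i = b i := by
    let S : Finset ℝ := (Finset.range n).image a
    have hS : ∀ t, t ∈ S ↔ t ∈ a '' Iio n := fun t => by simp [S]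
    have hcard : S.card = n := by
      rw [Finset.card_image_of_injOn (by simpa using ha.injOn), Finset.card_range]
    have e1 := Finset.orderEmbOfFin_unique hcard (f := fun i : Fin n => a i)
      (fun i => (hS _).2 ⟨i, i.2, rfl⟩) fun i j hij => ha i.2 j.2 hij
    have e2 := Finset.orderEmbOfFin_unique hcard (f := fun i : Fin n => b i)
      (fun i => (hS _).2 (himg ▸ ⟨i, i.2, rfl⟩)) fun i j hij => hb i.2 j.2 hij
    exact fun i hi => congrFun (e1.trans e2.symm) ⟨i, hi⟩
  refine ⟨rfl, hab, (eventually_comp_congr ha (strictMonoOn_natCast _)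
    (A := fun y => f y = g y) (hf.1.comp₂ hg.1 _)).1 ?_⟩
  filter_upwards [h] with x hx
  rw [hx]
  exact hg.1 fun i hi => by simp [hab i hi]

lemma exists_reduced (N : ℕ) (h : (ℕ → ℕ) → ℕ) (hh : DependsOn h (Iio N)) :
    ∃ (n : ℕ) (g : (ℕ → ℕ) → ℕ), Reduced n g ∧ ∃ c : ℕ → ℕ, StrictMonoOn c (Iio n) ∧
      MapsTo c (Iio n) (Iio N) ∧
      ∀ᶠ x : ℝ → ℕ in iteratedPower ℝ, g ((x ∘ Nat.cast) ∘ c) = h (x ∘ Nat.cast) := by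
  induction N generalizing h with
  | zero =>
    exact ⟨0, h, ⟨hh, fun i hi => absurd hi (Nat.not_lt_zero i)⟩, id, fun _ _ _ _ h => h,
      mapsTo_id _, .of_forall fun _ => rfl⟩
  | succ N ih =>
    by_cases hr : Reduced (N + 1) h
    · exact ⟨N + 1, h, hr, id, fun _ _ _ _ h => h, mapsTo_id _, .of_forall fun _ => rfl⟩
    · simp only [Reduced, hh, true_and, not_forall, not_not] at hr
      obtain ⟨i, hi, f', hf', hff'⟩ := hr
      let δ : ℕ → ℕ := fun j => if j < i then j else j + 1
      let σ : ℕ → ℕ := fun j => if j < i then j else j - 1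
      have hδ : StrictMono δ := fun j k hjk => by
        simp only [δ]
        split_ifs <;> omega
      have hδσ : ∀ j, j ≠ i → δ (σ j) = j := fun j hj => by
        simp only [δ, σ]
        split_ifs <;> omega
      obtain ⟨n, g, hg, c, hc, hcN, hgc⟩ := ih (fun y => f' (y ∘ σ)) (hf'.comp_right (by
        rintro j ⟨hj, hji⟩
        simp only [mem_Iio, mem_singleton_iff, σ] at *
        split_ifs <;> omega))
      refine ⟨n, g, hg, δ ∘ c, hδ.comp_strictMonoOn hc, fun j hj => ?_, ?_⟩
      · have := hcN hj
        simp only [Function.comp_apply, mem_Iio, δ] at *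
        split_ifs <;> omega
      · have hgc' := (eventually_comp_congr (strictMonoOn_natCast (Iio N))
          (b := fun j => ((δ j : ℕ) : ℝ)) ((Nat.strictMono_cast.comp hδ).strictMonoOn _)
          (A := fun y => g (y ∘ c) = f' (y ∘ σ))
          ((hg.1.comp_right hcN).comp₂ (hf'.comp_right (by
            rintro j ⟨hj, hji⟩
            simp only [mem_Iio, mem_singleton_iff, σ] at *
            split_ifs <;> omega)) _)).1 hgc
        filter_upwards [hgc', hff'] with x hx hx'
        rw [← hx']
        refine hx.trans (hf' fun j hj => ?_)
        simp [hδσ j hj.2]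

/-- A countable family of reduced functions, pairwise not almost surely equal, that is closed
under countably many operations. -/
lemma exists_reduced_family {J : Type} [Countable J] (ar : J → ℕ)
    (op : ∀ j, (Fin (ar j) → ℕ) → ℕ) :
    ∃ (I : Type) (_ : Countable I) (n : I → ℕ) (f : I → (ℕ → ℕ) → ℕ),
      (∀ i, Reduced (n i) (f i)) ∧ (∃ i, n i = 1) ∧
      (∀ i i', n i = n i' →
        (∀ᶠ x : ℝ → ℕ in iteratedPower ℝ, f i (x ∘ Nat.cast) = f i' (x ∘ Nat.cast)) → i = i') ∧
      ∀ (j : J) (p : Fin (ar j) → I) (N : ℕ) (c : Fin (ar j) → ℕ → ℕ),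
        (∀ i, MapsTo (c i) (Iio (n (p i))) (Iio N)) →
        ∃ (i₀ : I) (c' : ℕ → ℕ), StrictMonoOn c' (Iio (n i₀)) ∧
          MapsTo c' (Iio (n i₀)) (Iio N) ∧
          ∀ᶠ x : ℝ → ℕ in iteratedPower ℝ,
            f i₀ ((x ∘ Nat.cast) ∘ c') = op j fun i => f (p i) ((x ∘ Nat.cast) ∘ c i) := by
  classical
  have hred : ∀ (N : ℕ) (h : (ℕ → ℕ) → ℕ), ∃ g : ℕ × ((ℕ → ℕ) → ℕ), Reduced g.1 g.2 ∧
      (DependsOn h (Iio N) → ∃ c : ℕ → ℕ, StrictMonoOn c (Iio g.1) ∧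
        MapsTo c (Iio g.1) (Iio N) ∧
        ∀ᶠ x : ℝ → ℕ in iteratedPower ℝ, g.2 ((x ∘ Nat.cast) ∘ c) = h (x ∘ Nat.cast)) := by
    intro N h
    by_cases hh : DependsOn h (Iio N)
    · obtain ⟨n, g, hg, hc⟩ := exists_reduced N h hh
      exact ⟨(n, g), hg, fun _ => hc⟩
    · exact ⟨(1, fun y => y 0), reduced_eval_zero, fun h => absurd h hh⟩
  choose red hredR hred using hred
  let subst : ∀ j : J, (Fin (ar j) → List ℕ) → (Fin (ar j) → ℕ × ((ℕ → ℕ) → ℕ)) →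
      (ℕ → ℕ) → ℕ :=
    fun j l p y => op j fun i => (p i).2 (y ∘ fun t => (l i).getD t 0)
  obtain ⟨F₀, hF₀c, hF₀1, hF₀⟩ := exists_countable_closed
    (J := Σ j : J, ℕ × (Fin (ar j) → List ℕ)) (fun j => ar j.1)
    (fun j p => red j.2.1 (subst j.1 j.2.2 p)) (1, fun y => y 0)
  let q : ℕ × ((ℕ → ℕ) → ℕ) → ℕ × Filter.Germ (iteratedPower ℝ : Filter (ℝ → ℕ)) ℕ :=
    fun g => (g.1, ((fun x => g.2 (x ∘ Nat.cast) : (ℝ → ℕ) → ℕ) : Filter.Germ _ ℕ))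
  have hq : ∀ g g', q g = q g' ↔ g.1 = g'.1 ∧
      ∀ᶠ x : ℝ → ℕ in iteratedPower ℝ, g.2 (x ∘ Nat.cast) = g'.2 (x ∘ Nat.cast) := fun g g' => by
    simp only [q, Prod.mk.injEq, Filter.Germ.coe_eq]
    rfl
  obtain ⟨F, hFsub, hFbij⟩ := exists_subset_bijOn {g ∈ F₀ | Reduced g.1 g.2} q
  have hrep : ∀ g ∈ F₀, Reduced g.1 g.2 → ∃ g' ∈ F, q g' = q g := fun g hg hgR =>
    hFbij.surjOn ⟨g, ⟨hg, hgR⟩, rfl⟩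
  refine ⟨F, (hF₀c.mono fun g hg => (hFsub hg).1).to_subtype, fun g => g.1.1, fun g => g.1.2,
    fun g => (hFsub g.2).2, ?_, ?_, ?_⟩
  · obtain ⟨g', hg', hgq⟩ := hrep _ hF₀1 reduced_eval_zero
    exact ⟨⟨g', hg'⟩, ((hq _ _).1 hgq).1⟩
  · exact fun g g' h1 h2 => Subtype.ext (hFbij.injOn g.2 g'.2 ((hq _ _).2 ⟨h1, h2⟩))
  · intro j p N c hc
    let l : Fin (ar j) → List ℕ := fun i => (List.range (p i).1.1).map (c i)
    have hl : ∀ i, ∀ t < (p i).1.1, (l i).getD t 0 = c i t := fun i t ht => by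
      simp [l, ht]
    have hdep : ∀ i, DependsOn (p i).1.2 (Iio (p i).1.1) := fun i => (hFsub (p i).2).2.1
    have hsubst : ∀ y, subst j l (fun i => (p i).1) y = op j fun i => (p i).1.2 (y ∘ c i) :=
      fun y => congrArg (op j) <| funext fun i => hdep i fun t ht => congrArg y (hl i t ht)
    have hsubst_dep : DependsOn (subst j l fun i => (p i).1) (Iio N) := fun x y hxy => by
      rw [hsubst, hsubst]
      exact congrArg (op j) <| funext fun i => (hdep i).comp_right (hc i) hxy
    obtain ⟨c', hc', hc'N, hev⟩ := hred N _ hsubst_dep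
    obtain ⟨g', hg', hgq⟩ := hrep _
      (hF₀ ⟨j, N, l⟩ (fun i => (p i).1) fun i => (hFsub (p i).2).1) (hredR _ _)
    obtain ⟨hn, hge⟩ := (hq _ _).1 hgq
    simp only at hn hge
    rw [← hn] at hc' hc'N
    refine ⟨⟨g', hg'⟩, c', hc', hc'N, ?_⟩
    have hge' := (eventually_comp_congr (strictMonoOn_natCast _)
      (b := fun t => ((c' t : ℕ) : ℝ)) (Nat.strictMono_cast.comp_strictMonoOn hc')
      (A := fun y => g'.2 y = (red N (subst j l fun i => (p i).1)).2 y)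
      ((hFsub hg').2.1.comp₂ (hn ▸ (hredR _ _).1) _)).1 hge
    filter_upwards [hge', hev] with x h1 h2
    rw [← hsubst, ← h2]
    exact h1

section Model

variable {I : Type} (n : I → ℕ) (f : I → (ℕ → ℕ) → ℕ)

/-- Pairs of an index `i` and an increasing `n i`-tuple of reals, coded as a sequence vanishing from
`n i` on. -/
def tupleSpace : Set (I × (ℕ → ℝ)) :=
  {p | StrictMonoOn p.2 (Iio (n p.1)) ∧ ∀ j, n p.1 ≤ j → p.2 j = 0}

/-- The random natural number attached to a point of `tupleSpace n`. -/
def evalAt (p : tupleSpace n) (x : ℝ → ℕ) : ℕ := f p.1.1 (x ∘ p.1.2)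

variable {n f}

lemma evalAt_injective (hf : ∀ i, Reduced (n i) (f i))
    (hinj : ∀ i i', n i = n i' →
      (∀ᶠ x : ℝ → ℕ in iteratedPower ℝ, f i (x ∘ Nat.cast) = f i' (x ∘ Nat.cast)) → i = i')
    {p q : tupleSpace n}
    (h : ∀ᶠ x : ℝ → ℕ in iteratedPower ℝ, evalAt n f p x = evalAt n f q x) : p = q := by
  obtain ⟨⟨i, a⟩, ha, ha0⟩ := p
  obtain ⟨⟨i', b⟩, hb, hb0⟩ := q
  obtain ⟨hn, hab, hff⟩ := (hf i).eq_of_eventually_eq (hf i') ha hb h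
  obtain rfl := hinj i i' hn hff
  obtain rfl : a = b := funext fun j => by
    rcases lt_or_ge j (n i) with hj | hj
    · exact hab j hj
    · exact (ha0 j hj).trans (hb0 j hj).symm
  rfl

lemma exists_evalAt_eq {k : ℕ} {op : (Fin k → ℕ) → ℕ} (hf : ∀ i, Reduced (n i) (f i))
    (hop : ∀ (p : Fin k → I) (N : ℕ) (c : Fin k → ℕ → ℕ),
      (∀ i, MapsTo (c i) (Iio (n (p i))) (Iio N)) →
      ∃ (i₀ : I) (c' : ℕ → ℕ), StrictMonoOn c' (Iio (n i₀)) ∧ MapsTo c' (Iio (n i₀)) (Iio N) ∧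
        ∀ᶠ x : ℝ → ℕ in iteratedPower ℝ,
          f i₀ ((x ∘ Nat.cast) ∘ c') = op fun i => f (p i) ((x ∘ Nat.cast) ∘ c i))
    (v : Fin k → tupleSpace n) :
    ∃ d : tupleSpace n, ∀ᶠ x : ℝ → ℕ in iteratedPower ℝ,
      evalAt n f d x = op fun i => evalAt n f (v i) x := by
  classical
  let S : Finset ℝ := Finset.univ.biUnion fun i => (Finset.range (n (v i).1.1)).image (v i).1.2
  let b : ℕ → ℝ := fun j => if h : j < S.card then S.orderEmbOfFin rfl ⟨j, h⟩ else 0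
  have hb : StrictMonoOn b (Iio S.card) := fun i hi j hj hij => by
    simp only [mem_Iio] at hi hj
    simpa [b, hi, hj] using hij
  have hbS : ∀ t ∈ S, t ∈ b '' Iio S.card := fun t ht => by
    have : t ∈ range (S.orderEmbOfFin rfl) := by simpa using ht
    obtain ⟨i, rfl⟩ := this
    exact ⟨i, i.2, by simp [b]⟩
  let c : Fin k → ℕ → ℕ := fun i j => Function.invFunOn b (Iio S.card) ((v i).1.2 j)
  have hvS : ∀ i, ∀ j < n (v i).1.1, (v i).1.2 j ∈ b '' Iio S.card := fun i j hj =>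
    hbS _ (Finset.mem_biUnion.2 ⟨i, Finset.mem_univ _,
      Finset.mem_image_of_mem _ (Finset.mem_range.2 hj)⟩)
  have hc : ∀ i, MapsTo (c i) (Iio (n (v i).1.1)) (Iio S.card) := fun i j hj =>
    Function.invFunOn_mem (hvS i j hj)
  have hbc : ∀ i, ∀ j < n (v i).1.1, b (c i j) = (v i).1.2 j := fun i j hj =>
    Function.invFunOn_eq (hvS i j hj)
  obtain ⟨i₀, c', hc', hc'N, h⟩ := hop (fun i => (v i).1.1) S.card c hc
  let a : ℕ → ℝ := fun j => if j < n i₀ then b (c' j) else 0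
  have hmem : (i₀, a) ∈ tupleSpace n := by
    refine ⟨fun i hi j hj hij => ?_, fun j hj => if_neg (not_lt.2 hj)⟩
    simp only [mem_Iio] at hi hj
    simpa [a, hi, hj] using hb (hc'N hi) (hc'N hj) (hc' hi hj hij)
  refine ⟨⟨(i₀, a), hmem⟩, ?_⟩
  have hdep : DependsOn (fun y : ℕ → ℕ => op fun i => f (v i).1.1 (y ∘ c i)) (Iio S.card) :=
    fun x y hxy => congrArg op <| funext fun i => ((hf _).1.comp_right (hc i)) hxy
  have h' := (eventually_comp_congr (strictMonoOn_natCast _) hb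
    (A := fun y => f i₀ (y ∘ c') = op fun i => f (v i).1.1 (y ∘ c i))
    (((hf i₀).1.comp_right hc'N).comp₂ hdep _)).1 h
  filter_upwards [h'] with x hx
  have e1 : evalAt n f ⟨(i₀, a), hmem⟩ x = f i₀ ((x ∘ b) ∘ c') :=
    (hf i₀).1 fun j hj => by simp [a, mem_Iio.1 hj]
  have e2 : ∀ i, evalAt n f (v i) x = f (v i).1.1 ((x ∘ b) ∘ c i) := fun i =>
    (hf _).1 fun j hj => by simp [hbc i j hj]
  rw [e1, hx]
  simp only [e2]

lemma measurableSet_of_countable {Z C : Type} [MeasurableSpace Z] [Countable C]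
    [MeasurableSpace C] [DiscreteMeasurableSpace C] {g : Z → C} (hg : Measurable g)
    {P : C → Z → Prop} (h : ∀ c, MeasurableSet {z | P c z}) : MeasurableSet {z | P (g z) z} := by
  have : {z | P (g z) z} = ⋃ c, g ⁻¹' {c} ∩ {z | P c z} := by
    ext z
    simp
  rw [this]
  exact .iUnion fun c => (hg (.of_discrete)).inter (h c)

lemma measurableSet_tupleSpace [Countable I] [MeasurableSpace I] [DiscreteMeasurableSpace I] :
    MeasurableSet (tupleSpace n) := by
  refine measurableSet_of_countable (g := Prod.fst) measurable_fst
    (P := fun i p => StrictMonoOn p.2 (Iio (n i)) ∧ ∀ j, n i ≤ j → p.2 j = 0) fun i => ?_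
  have hm : ∀ j : ℕ, Measurable fun p : I × (ℕ → ℝ) => p.2 j := fun j => by fun_prop
  simp only [StrictMonoOn, ofPred_and, ofPred_forall]
  refine .inter ?_ ?_
  · exact .iInter fun j => .iInter fun _ => .iInter fun k => .iInter fun _ => .iInter fun _ =>
      measurableSet_lt (hm j) (hm k)
  · exact .iInter fun j => .iInter fun _ => hm j (measurableSet_singleton 0)

lemma measurableSet_eventually_evalAt [Countable I] [MeasurableSpace I]
    [DiscreteMeasurableSpace I] (hf : ∀ i, DependsOn (f i) (Iio (n i))) {k : ℕ}
    (R : (Fin k → ℕ) → Prop) :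
    MeasurableSet {v : Fin k → tupleSpace n |
      ∀ᶠ x in iteratedPower ℝ, R fun i => evalAt n f (v i) x} := by
  have hfst : Measurable fun (v : Fin k → tupleSpace n) i => (v i).1.1 := by fun_prop
  refine measurableSet_of_countable hfst
    (P := fun s v => ∀ᶠ x in iteratedPower ℝ, R fun i => f (s i) (x ∘ (v i).1.2)) fun s => ?_
  let N : ℕ := Finset.univ.sup fun i => n (s i)
  have hN : ∀ i, n (s i) ≤ N := fun i => Finset.le_sup (f := fun i => n (s i)) (Finset.mem_univ i)
  let κ : Type := Fin k × Fin N
  let c : (Fin k → tupleSpace n) → κ → ℝ := fun v t => (v t.1).1.2 t.2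
  have hc : ∀ t, Measurable fun v => c v t := fun t => by fun_prop
  let g : (Fin k → tupleSpace n) → κ → κ → Prop := fun v t u => c v t ≤ c v u
  have hg : Measurable g := measurable_pi_lambda _ fun t => measurable_pi_lambda _ fun u =>
    measurable_to_prop (by simpa [preimage] using measurableSet_le (hc t) (hc u))
  let A : (κ → ℕ) → Prop := fun y =>
    R fun i => f (s i) fun j => if h : j < N then y (i, ⟨j, h⟩) else 0
  have hA : ∀ v x, A (x ∘ c v) ↔ R fun i => f (s i) (x ∘ (v i).1.2) := fun v x => by
    have : ∀ i, f (s i) (fun j => if h : j < N then (x ∘ c v) (i, ⟨j, h⟩) else 0) =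
        f (s i) (x ∘ (v i).1.2) := fun i => hf _ fun j hj => by
      simp [c, (mem_Iio.1 hj).trans_le (hN i)]
    simp only [A, this]
  have key : {v : Fin k → tupleSpace n |
      ∀ᶠ x in iteratedPower ℝ, R fun i => f (s i) (x ∘ (v i).1.2)} =
      g ⁻¹' {q | ∃ v, g v = q ∧
        ∀ᶠ x in iteratedPower ℝ, R fun i => f (s i) (x ∘ (v i).1.2)} := by
    ext v
    refine ⟨fun hv => ⟨v, rfl, hv⟩, ?_⟩
    rintro ⟨w, hw, hwR⟩
    simp only [mem_ofPred_eq, ← hA] at hwR ⊢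
    exact (eventually_iteratedPower_pattern
      (fun t u => iff_of_eq (congrFun (congrFun hw t) u)) A).1 hwR
  rw [key]
  exact hg .of_discrete

end Model

lemma exists_eq_var {L : FirstOrder.Language.{0, 0}} [L.IsRelational] {m : ℕ} :
    ∀ t : L.Term (Empty ⊕ Fin m), ∃ i, t = Term.var (Sum.inr i)
  | .var (.inl a) => a.elim
  | .var (.inr i) => ⟨i, rfl⟩
  | .func g _ => isEmptyElim g

section Los

variable {L} [L.IsRelational] {D Ω : Type} (𝒱 : Ultrafilter Ω) (ev : D → Ω → ℕ)

/-- The structure on a set of random elements of a structure on `ℕ` in which a relation holds when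
it holds almost surely. -/
@[reducible]
def randomStructure [L.Structure ℕ] : L.Structure D where
  funMap := fun f _ => isEmptyElim f
  RelMap := fun r v => ∀ᶠ x in 𝒱, Structure.RelMap r fun i => ev (v i) x

variable {𝒱 ev}

lemma realize_randomStructure [L.Structure ℕ]
    (hinj : ∀ d d', (∀ᶠ x in 𝒱, ev d x = ev d' x) → d = d')
    (hwit : ∀ (m : ℕ) (φ : L.BoundedFormula Empty (m + 1)) (v : Fin m → D), ∃ d, ∀ᶠ x in 𝒱,
      ev d x = sInf {w | ¬ φ.Realize default (Fin.snoc (fun i => ev (v i) x) w : Fin (m + 1) → ℕ)})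
    {m : ℕ} (φ : L.BoundedFormula Empty m) (v : Fin m → D) :
    letI := randomStructure (L := L) 𝒱 ev
    φ.Realize default v ↔ ∀ᶠ x in 𝒱, φ.Realize default fun i => ev (v i) x := by
  let := randomStructure (L := L) 𝒱 ev
  induction φ with
  | falsum => simp [BoundedFormula.Realize, 𝒱.neBot.ne]
  | equal t₁ t₂ =>
    obtain ⟨i, rfl⟩ := exists_eq_var t₁
    obtain ⟨j, rfl⟩ := exists_eq_var t₂
    simp only [BoundedFormula.Realize, Term.realize_var, Sum.elim_inr]
    exact ⟨fun h => .of_forall fun x => by rw [h], hinj _ _⟩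
  | rel r ts =>
    choose i hi using fun j => exists_eq_var (ts j)
    obtain rfl : ts = fun j => Term.var (Sum.inr (i j)) := funext hi
    simp only [BoundedFormula.Realize, Term.realize_var, Sum.elim_inr]
    rfl
  | imp φ ψ ih₁ ih₂ =>
    simp only [BoundedFormula.realize_imp, ih₁, ih₂, Ultrafilter.eventually_imp]
  | @all m φ ih =>
    have hsnoc : ∀ (d : D) x, (fun i => ev ((Fin.snoc v d : Fin (m + 1) → D) i) x) =
        (Fin.snoc (fun i => ev (v i) x) (ev d x) : Fin (m + 1) → ℕ) := fun d x => by
      funext i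
      refine Fin.lastCases ?_ (fun i => ?_) i <;> simp
    simp only [BoundedFormula.realize_all, ih, hsnoc]
    constructor
    · intro h
      obtain ⟨d, hd⟩ := hwit m φ v
      filter_upwards [h d, hd] with x hx hdx
      by_contra hne
      rw [not_forall] at hne
      rw [hdx] at hx
      exact Nat.sInf_mem (s := {w | ¬ φ.Realize default
        (Fin.snoc (fun i => ev (v i) x) w : Fin (m + 1) → ℕ)}) hne hx
    · exact fun h d => h.mono fun x hx => hx _

end Los

/-- Every structure on `ℕ` in a countable relational language is elementarily equivalent to a Borel
structure of cardinality continuum. -/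
theorem exists_borelStruct_elementarilyEquivalent {L : FirstOrder.Language.{0, 0}}
    [L.IsRelational] [∀ n, Countable (L.Relations n)] (M : L.Structure ℕ) :
    ∃ B : BorelStruct L, Cardinal.mk B.dom = Cardinal.continuum ∧
      ∀ φ : L.Sentence, SatSIn L B.dom B.str φ ↔ SatSIn L ℕ M φ := by
  have : Countable L.Symbols := inferInstanceAs (Countable ((Σ l, L.Functions l) ⊕ _))
  have : Countable (Σ m, L.BoundedFormula Empty (m + 1)) :=
    Function.Injective.countable
      (f := fun j => (⟨j.1 + 1, j.2⟩ : Σ m, L.BoundedFormula Empty m)) (by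
        rintro ⟨m, φ⟩ ⟨m', φ'⟩ h
        simpa using h)
  obtain ⟨I, _, n, f, hf, ⟨i₁, hi₁⟩, hinj, hop⟩ := exists_reduced_family
    (J := Σ m, L.BoundedFormula Empty (m + 1)) (fun j => j.1)
    (fun j y => sInf {w | ¬ j.2.Realize default (Fin.snoc y w : Fin (j.1 + 1) → ℕ)})
  let : MeasurableSpace I := ⊤
  have : DiscreteMeasurableSpace I := ⟨fun _ => trivial⟩
  have : StandardBorelSpace (tupleSpace n) := measurableSet_tupleSpace.standardBorel
  let single : ℝ → tupleSpace n := fun r => ⟨(i₁, fun j => if j = 0 then r else 0), by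
    intro i hi j hj hij
    simp only [mem_Iio, hi₁] at hi hj
    omega, fun j hj => if_neg (by simp only [hi₁] at hj; omega)⟩
  have hsingle : Function.Injective single := fun r s h => by
    simpa [single] using congrFun (congrArg (fun p : tupleSpace n => p.1.2) h) 0
  let : L.Structure (tupleSpace n) := randomStructure (iteratedPower ℝ) (evalAt n f)
  refine ⟨⟨tupleSpace n, fun k r => measurableSet_eventually_evalAt (fun i => (hf i).1) _⟩,
    ?_, fun φ => ?_⟩
  · have hunc : ¬ Countable (tupleSpace n) := fun h =>
      not_countable (α := ℝ) (hsingle.countable)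
    rw [← Cardinal.mk_real]
    exact Cardinal.mk_congr
      (PolishSpace.measurableEquivOfNotCountable hunc (not_countable (α := ℝ))).toEquiv
  · refine (realize_randomStructure (fun d d' => evalAt_injective hf hinj)
      (fun m φ v => exists_evalAt_eq (op := fun y => sInf {w | ¬ φ.Realize default
        (Fin.snoc y w : Fin (m + 1) → ℕ)}) hf (hop ⟨m, φ⟩) v) φ default).trans ?_
    have hempty : ∀ x : ℝ → ℕ,
        (fun i => evalAt n f ((default : Fin 0 → tupleSpace n) i) x) = default :=
      fun x => Subsingleton.elim _ _
    simp only [hempty, Filter.eventually_const]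
    rw [SatSIn, Sentence.Realize, Formula.Realize]
    exact iff_of_eq (congrArg₂ (BoundedFormula.Realize φ) (Subsingleton.elim _ _)
      (Subsingleton.elim _ _))

lemma measurableSet_extS [L.IsRelational] (φ : L.Sentence) : MeasurableSet (extS L φ) := by
  have key : ∀ {m : ℕ} (φ : L.BoundedFormula Empty m) (v : Fin m → ℕ),
      MeasurableSet {x : StrL L | letI := toStructure L x; φ.Realize default v} := by
    intro m φ
    induction φ with
    | falsum => exact fun v => .empty
    | equal t₁ t₂ =>
      intro v
      obtain ⟨i, rfl⟩ := exists_eq_var t₁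
      obtain ⟨j, rfl⟩ := exists_eq_var t₂
      exact .const (v i = v j)
    | @rel m k r ts =>
      intro v
      choose i hi using fun j => exists_eq_var (ts j)
      obtain rfl : ts = fun j => Term.var (Sum.inr (i j)) := funext hi
      have : Measurable fun x : StrL L => x k r fun j => v (i j) := by fun_prop
      exact this (measurableSet_singleton true)
    | imp φ ψ ih₁ ih₂ => exact fun v => (ih₁ v).imp (ih₂ v)
    | all φ ih =>
      intro v
      simp only [BoundedFormula.realize_all, ofPred_forall]
      exact .iInter fun w => ih _
  simp only [extS, SatS, Sentence.Realize, Formula.Realize]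
  convert key (m := 0) φ default

/-- The almost-sure first-order theory of an ergodic structure has a Borel model of
cardinality continuum. -/
theorem statement17 [L.IsRelational] [∀ n, Countable (L.Relations n)]
    (μ : Measure (StrL L)) (hμ : IsErgodicStructure L μ) :
    ∃ B : BorelStruct L, Cardinal.mk B.dom = Cardinal.continuum ∧
      ∀ φ : L.Sentence, μ (extS L φ) = 1 → SatSIn L B.dom B.str φ := by
  have := hμ.1
  have : Countable L.Symbols := inferInstanceAs (Countable ((Σ l, L.Functions l) ⊕ _))
  have hae : ∀ᵐ x ∂μ, ∀ φ : L.Sentence, μ (extS L φ) = 1 → x ∈ extS L φ := by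
    refine ae_all_iff.2 fun φ => ?_
    by_cases hφ : μ (extS L φ) = 1
    · filter_upwards [(mem_ae_iff_prob_eq_one (measurableSet_extS L φ)).2 hφ] with x hx _ using hx
    · exact .of_forall fun x h => absurd h hφ
  obtain ⟨x, hx⟩ := hae.exists
  obtain ⟨B, hB, hBφ⟩ := exists_borelStruct_elementarilyEquivalent (toStructure L x)
  exact ⟨B, hB, fun φ hφ => (hBφ φ).2 (hx φ hφ)⟩

end Ergo
end

section
/- Let L = {P_n : n ∈ ℕ} consist of countably many unary relation symbols, and let μ_P be the law of the random structure on ℕ in which the events 'P_n(i) holds', for (n, i) ∈ ℕ × ℕ, are i.i.d. with probability 1/2. Then: (a) μ_P-almost surely, no complete quantifier-free 1-type is realized by two distinct elements, i.e., for all i ≠ j in ℕ there is some n with P_n(i) holding and P_n(j) failing or vice versa; and (b) μ_P is properly ergodic: every isomorphism class {N ∈ Str_L : N ≅ M} is μ_P-null. -/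
open FirstOrder Language MeasureTheory Set
open scoped ENNReal

namespace Ergo


variable (L : FirstOrder.Language.{0,0})

/-- The relations of the kaleidoscope predicate language: countably many unary relations. -/
def predRel : ℕ → Type
  | 1 => ℕ
  | _ => Empty

/-- The kaleidoscope predicate language `L = {Pₙ : n ∈ ℕ}`, all unary. -/
def predLang : FirstOrder.Language.{0,0} := ⟨fun _ => Empty, predRel⟩

/-- Cylinder sets of the kaleidoscope random predicate fixing all coordinates of a
single element are null. -/
theorem measure_setOf_row_eq_eq_zero {μ : Measure (StrL predLang)}
    (hiid : ∀ (F : Finset (ℕ × ℕ)) (ε : ℕ × ℕ → Bool),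
      μ {x : StrL predLang | ∀ t ∈ F, x 1 t.1 ![t.2] = ε t} = (1 / 2 : ℝ≥0∞) ^ F.card)
    (i : ℕ) (c : ℕ → Bool) :
    μ {x : StrL predLang | ∀ n : ℕ, x 1 n ![i] = c n} = 0 := by
  have hlim := ENNReal.tendsto_pow_atTop_nhds_zero_of_lt_one
    (r := (1 / 2 : ℝ≥0∞)) (by simp [ENNReal.inv_lt_one])
  refine le_antisymm (ge_of_tendsto' hlim fun N => ?_) zero_le
  have h := hiid (Finset.range N ×ˢ {i}) fun t => c t.1
  rw [Finset.card_product, Finset.card_range, Finset.card_singleton, mul_one] at h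
  rw [← h]
  refine measure_mono fun x hx t ht => ?_
  obtain ⟨n, j⟩ := t
  obtain rfl : j = i := by simpa using (Finset.mem_product.1 ht).2
  exact hx n

/-- Two distinct elements of the kaleidoscope random predicate almost surely have distinct
quantifier-free types. -/
theorem measure_setOf_rows_eq_eq_zero {μ : Measure (StrL predLang)}
    (hiid : ∀ (F : Finset (ℕ × ℕ)) (ε : ℕ × ℕ → Bool),
      μ {x : StrL predLang | ∀ t ∈ F, x 1 t.1 ![t.2] = ε t} = (1 / 2 : ℝ≥0∞) ^ F.card)
    {i j : ℕ} (hij : i ≠ j) :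
    μ {x : StrL predLang | ∀ n : ℕ, x 1 n ![i] = x 1 n ![j]} = 0 := by
  have hlim := ENNReal.tendsto_pow_atTop_nhds_zero_of_lt_one
    (r := (1 / 2 : ℝ≥0∞)) (by simp [ENNReal.inv_lt_one])
  refine le_antisymm (ge_of_tendsto' hlim fun N => ?_) zero_le
  let cyl : Finset ℕ → Set (StrL predLang) := fun S =>
    {x | ∀ t ∈ Finset.range N ×ˢ ({i, j} : Finset ℕ), x 1 t.1 ![t.2] = decide (t.1 ∈ S)}
  have hcyl (S : Finset ℕ) : μ (cyl S) = (1 / 2 : ℝ≥0∞) ^ (N * 2) := by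
    have h := hiid (Finset.range N ×ˢ {i, j}) fun t => decide (t.1 ∈ S)
    rwa [Finset.card_product, Finset.card_range, Finset.card_pair hij] at h
  have hsub : {x : StrL predLang | ∀ n : ℕ, x 1 n ![i] = x 1 n ![j]} ⊆
      ⋃ S ∈ (Finset.range N).powerset, cyl S := by
    intro x hx
    simp only [Set.mem_iUnion]
    refine ⟨(Finset.range N).filter fun n : ℕ => x 1 n ![i] = true,
      Finset.mem_powerset.2 (Finset.filter_subset _ _), ?_⟩
    rintro ⟨n, k⟩ ht
    obtain ⟨hn, hk⟩ : n ∈ Finset.range N ∧ k ∈ ({i, j} : Finset ℕ) := Finset.mem_product.1 ht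
    have hk' : x 1 n ![k] = x 1 n ![i] := by
      rcases Finset.mem_insert.1 hk with rfl | hk
      · rfl
      · obtain rfl : k = j := Finset.mem_singleton.1 hk
        exact (hx n).symm
    have hn' : n < N := Finset.mem_range.1 hn
    simp [hk', hn']
  calc μ {x : StrL predLang | ∀ n : ℕ, x 1 n ![i] = x 1 n ![j]}
      ≤ ∑ S ∈ (Finset.range N).powerset, μ (cyl S) :=
        (measure_mono hsub).trans (measure_biUnion_finset_le _ _)
    _ = 2 ^ N * (1 / 2 : ℝ≥0∞) ^ (N * 2) := by
        simp only [hcyl, Finset.sum_const, Finset.card_powerset, Finset.card_range, nsmul_eq_mul]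
        norm_cast
    _ = (1 / 2 : ℝ≥0∞) ^ N := by
        rw [mul_two, pow_add, ← mul_assoc, ← mul_pow, one_div,
          ENNReal.mul_inv_cancel two_ne_zero ENNReal.ofNat_ne_top, one_pow, one_mul]

/-- The kaleidoscope random predicate μ_P, in which the events `Pₙ(i)` are i.i.d.
Bernoulli(1/2): (a) almost surely no complete quantifier-free 1-type is realized twice
(distinct elements are separated by some Pₙ), and (b) μ_P is properly ergodic: every
isomorphism class is μ_P-null. -/
theorem statement19 (μP : Measure (StrL predLang))
    (hiid : ∀ (F : Finset (ℕ × ℕ)) (ε : ℕ × ℕ → Bool),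
      μP {x : StrL predLang | ∀ t ∈ F, x 1 t.1 ![t.2] = ε t} = (1 / 2 : ℝ≥0∞) ^ F.card) :
    μP {x : StrL predLang | ∀ i j : ℕ, i ≠ j → ∃ n : ℕ, x 1 n ![i] ≠ x 1 n ![j]} = 1 ∧
    OrbitsNull predLang μP := by
  constructor
  · have huniv : μP Set.univ = 1 := by simpa using hiid ∅ fun _ => false
    rw [← huniv]
    refine measure_congr (ae_eq_univ.2 ?_)
    refine measure_mono_null (t := ⋃ (i : ℕ) (j : ℕ) (_ : i ≠ j),
      {x : StrL predLang | ∀ n : ℕ, x 1 n ![i] = x 1 n ![j]}) (fun x hx => ?_) ?_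
    · simp only [Set.mem_compl_iff, Set.mem_ofPred_eq] at hx
      push Not at hx
      obtain ⟨i, j, hij, h⟩ := hx
      simp only [Set.mem_iUnion]
      exact ⟨i, j, hij, h⟩
    · simp only [measure_iUnion_null_iff]
      exact fun i j hij => measure_setOf_rows_eq_eq_zero hiid hij
  · intro M
    refine measure_mono_null (t := ⋃ k : ℕ,
      {x : StrL predLang | ∀ n : ℕ, x 1 n ![0] = M 1 n ![k]}) ?_
      (measure_iUnion_null fun k => measure_setOf_row_eq_eq_zero hiid 0 fun n => M 1 n ![k])
    rintro _ ⟨σ, rfl⟩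
    refine Set.mem_iUnion.2 ⟨σ.symm 0, fun n => congrArg (M 1 n) ?_⟩
    ext a
    fin_cases a
    rfl

end Ergo
end
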